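/- arXiv:2401.07546 — 3 statements merged into one kernel-verified Lean document; each statement's English description precedes it below -/
import Mathlib

section
/- Let X_1, …, X_p be C^∞ complete vector fields on ℝ^N, let (i_1,…,i_r) be an r-tuple of indices with 1 ≤ i_j ≤ p, let K ⊂ ℝ^N be compact and η > 0. Then there exists δ_0 > 0 such that for every δ ∈ (0, δ_0) there is a one-parameter family of maps f^{(δ)}_t : ℝ^N → ℝ^N, t ∈ (−δ/2, δ/2), depending smoothly on t, with the following properties: (1) there exist an integer A ≥ 1, indices ℓ_1, …, ℓ_A ∈ {1,…,p} and C^∞ real functions σ_1(t), …, σ_{2A}(t) such that f^{(δ)}_t = Φ^{X_{ℓ_A}}_{σ_{2A}(t)} ∘ Φ^{X_{ℓ_{A−1}}}_{σ_{2A−1}(t)} ∘ ⋯ ∘ Φ^{X_{ℓ_1}}_{σ_{A+1}(t)} ∘ Φ^{X_{ℓ_1}}_{σ_A(t)} ∘ Φ^{X_{ℓ_2}}_{σ_{A−1}(t)} ∘ ⋯ ∘ Φ^{X_{ℓ_A}}_{σ_1(t)}; (2) f^{(δ)}_0 = id; (3) for every y ∈ K, ‖(d/dt f^{(δ)}_t(y))|_{t=0}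 − X_{(i_1,…,i_r)}(y)‖ < η. -/
noncomputable section
open Set

variable {E : Type*} [NormedAddCommGroup E] [NormedSpace ℝ E]

/-- Lie bracket of vector fields: `[X,Y](x) = DY(x)·X(x) − DX(x)·Y(x)`. -/
def lieBracket (X Y : E → E) : E → E := fun x => fderiv ℝ Y x (X x) - fderiv ℝ X x (Y x)

/-- Nested Lie bracket `X_{(i₁,…,i_r)}` indexed by a list of indices. -/
def nestedBracket {p : ℕ} (X : Fin p → E → E) : List (Fin p) → E → E
  | [] => fun _ => 0
  | [i] => X i
  | i :: j :: l => lieBracket (X i) (nestedBracket X (j :: l))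

/-- The composition of the flows `Φ` along a list of (index, time) pairs, the head of the
list being the outermost flow. -/
def compFlows {p : ℕ} (Φ : Fin p → ℝ → E → E) : List (Fin p × ℝ) → E → E
  | [] => id
  | (i, s) :: l => fun y => Φ i s (compFlows Φ l y)

section Aux

open Filter Topology Metric

/-- uniqueness -/
theorem flow_unique_aux {E : Type*} [NormedAddCommGroup E] [NormedSpace ℝ E]
    [FiniteDimensional ℝ E] {X : E → E} (hX : ContDiff ℝ 1 X) {f g : ℝ → E} {ε : ℝ} (hε : 0 < ε)
    (hf : ∀ t ∈ Icc (-ε) ε, HasDerivWithinAt f (X (f t)) (Icc (-ε) ε) t)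
    (hg : ∀ t ∈ Icc (-ε) ε, HasDerivWithinAt g (X (g t)) (Icc (-ε) ε) t)
    (h0 : f 0 = g 0) : EqOn f g (Icc (-ε) ε) := by
  have hfc : ContinuousOn f (Icc (-ε) ε) := fun t ht => (hf t ht).continuousWithinAt
  have hgc : ContinuousOn g (Icc (-ε) ε) := fun t ht => (hg t ht).continuousWithinAt
  have := FiniteDimensional.proper ℝ E
  have hbd : Bornology.IsBounded (f '' Icc (-ε) ε ∪ g '' Icc (-ε) ε) :=
    ((isCompact_Icc.image_of_continuousOn hfc).union
      (isCompact_Icc.image_of_continuousOn hgc)).isBounded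
  obtain ⟨R, hR⟩ := hbd.subset_closedBall (0 : E)
  obtain ⟨C, hC⟩ := (isCompact_closedBall (0 : E) R).exists_bound_of_continuousOn
    (hX.continuous_fderiv one_ne_zero).continuousOn
  have hlip : LipschitzOnWith (Real.toNNReal C) X (closedBall (0 : E) R) := by
    apply Convex.lipschitzOnWith_of_nnnorm_fderiv_le
      (fun x _ => (hX.differentiable one_ne_zero) x) _ (convex_closedBall _ _)
    intro x hx
    rw [← NNReal.coe_le_coe]
    exact (hC x hx).trans (Real.le_coe_toNNReal C)
  refine ODE_solution_unique_of_mem_Icc (v := fun _ => X) (s := fun _ => closedBall 0 R)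
    (K := Real.toNNReal C) (t₀ := 0) (fun t _ => hlip) (by constructor <;> linarith) hfc
    (fun t ht => (hf t (Ioo_subset_Icc_self ht)).hasDerivAt (Icc_mem_nhds ht.1 ht.2))
    (fun t ht => hR (Or.inl ⟨t, Ioo_subset_Icc_self ht, rfl⟩)) hgc
    (fun t ht => (hg t (Ioo_subset_Icc_self ht)).hasDerivAt (Icc_mem_nhds ht.1 ht.2))
    (fun t ht => hR (Or.inr ⟨t, Ioo_subset_Icc_self ht, rfl⟩)) h0

/-- uniform first order expansion in time -/
theorem unif_expansion_aux {E F : Type*} [NormedAddCommGroup E] [NormedSpace ℝ E]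
    [NormedAddCommGroup F] [NormedSpace ℝ F] {a b : ℝ × E → F} {y₀ : E}
    (hd : ∀ᶠ p in 𝓝 ((0 : ℝ), y₀), HasDerivAt (fun s => a (s, p.2)) (b p) p.1)
    (hb : ContinuousAt b (0, y₀)) {ε : ℝ} (hε : 0 < ε) :
    ∀ᶠ p in 𝓝 ((0 : ℝ), y₀), ‖a p - a (0, p.2) - p.1 • b (0, p.2)‖ ≤ ε * |p.1| := by
  have h1 : ∀ᶠ p in 𝓝 ((0 : ℝ), y₀), ‖b p - b (0, y₀)‖ < ε / 2 := by
    have := Metric.tendsto_nhds.1 hb (ε / 2) (half_pos hε)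
    simpa [dist_eq_norm] using this
  obtain ⟨δ, hδ, h⟩ := Metric.eventually_nhds_iff_ball.1 (hd.and h1)
  filter_upwards [ball_mem_nhds _ hδ] with p hp
  obtain ⟨s, y⟩ := p
  have hmem : ∀ τ : ℝ, |τ| < δ → (τ, y) ∈ ball ((0 : ℝ), y₀) δ := by
    intro τ hτ
    rw [← ball_prod_same] at hp ⊢
    exact ⟨by simpa using hτ, hp.2⟩
  have hs : |s| < δ := by
    rw [← ball_prod_same] at hp
    simpa using hp.1
  have key := (convex_ball (0 : ℝ) δ).norm_image_sub_le_of_norm_hasDerivWithin_le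
    (f := fun τ => a (τ, y) - τ • b (0, y)) (f' := fun τ => b (τ, y) - b (0, y)) (C := ε)
    (x := 0) (y := s) ?_ ?_ (by simpa using hδ) (by simpa using hs)
  · simp only [zero_smul, sub_zero, Real.norm_eq_abs] at key
    convert key using 2
    abel
  · intro τ hτ
    have := (h _ (hmem τ (by simpa using hτ))).1
    have h2 := this.sub ((hasDerivAt_id τ).smul_const (b (0, y)))
    rw [one_smul] at h2
    exact h2.hasDerivWithinAt
  · intro τ hτ
    have e1 := (h _ (hmem τ (by simpa using hτ))).2
    have e2 := (h _ (hmem 0 (by simpa using hδ))).2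
    calc ‖b (τ, y) - b (0, y)‖ = ‖(b (τ, y) - b (0, y₀)) - (b (0, y) - b (0, y₀))‖ := by
          congr 1; abel
      _ ≤ _ := norm_sub_le _ _
      _ ≤ ε := by linarith

theorem local_flow_aux {E : Type*} [NormedAddCommGroup E] [NormedSpace ℝ E]
    [FiniteDimensional ℝ E] {X : E → E} (hX : ContDiff ℝ (⊤ : ℕ∞) X) {Φ : ℝ → E → E}
    (h0 : ∀ y, Φ 0 y = y)
    (hd : ∀ t y, HasDerivAt (fun s => Φ s y) (X (Φ t y)) t) (y₀ : E) :
    ∃ ε > (0 : ℝ), ∃ r > (0 : ℝ), ∃ (L : NNReal) (N : ℝ × E → E →L[ℝ] E),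
      (∀ t ∈ Icc (-ε) ε, LipschitzOnWith L (Φ t) (closedBall y₀ r)) ∧
      (∀ y ∈ closedBall y₀ r, N (0, y) = ContinuousLinearMap.id ℝ E ∧ ∀ t ∈ Ioo (-ε) ε,
        HasDerivAt (fun s => N (s, y)) (-((N (t, y)).comp (fderiv ℝ X (Φ t y)))) t) ∧
      ContinuousOn N (Icc (-ε) ε ×ˢ closedBall y₀ r) ∧
      ContinuousOn (fun p : ℝ × E => Φ p.1 p.2) (Icc (-ε) ε ×ˢ closedBall y₀ r) := by
  have : CompleteSpace E := FiniteDimensional.complete ℝ E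
  have hX1 : ContDiff ℝ 1 X := hX.of_le (by exact_mod_cast le_top)
  have hX2 : ContDiff ℝ 1 (fderiv ℝ X) := (contDiff_infty_iff_fderiv.1 hX).2.of_le
    (by exact_mod_cast le_top)
  let V : E × (E →L[ℝ] E) → E × (E →L[ℝ] E) :=
    fun q => (X q.1, -(q.2.comp (fderiv ℝ X q.1)))
  have hV : ContDiff ℝ 1 V := by
    apply ContDiff.prodMk
    · exact hX1.comp contDiff_fst
    · exact (contDiff_snd.clm_comp (hX2.comp contDiff_fst)).neg
  obtain ⟨ε, hε, a, r, L₀, K₀, hr, hpl⟩ :=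
    IsPicardLindelof.of_contDiffAt_one (hV.contDiffAt (x := (y₀, ContinuousLinearMap.id ℝ E)))
  have hpl0 := hpl 0
  obtain ⟨α, hα, L, hL⟩ := hpl0.exists_forall_mem_closedBall_eq_hasDerivWithinAt_lipschitzOnWith
  simp only [zero_sub, zero_add] at hα hL
  have hmem : ∀ y ∈ closedBall y₀ (r : ℝ), ((y, ContinuousLinearMap.id ℝ E) : E × (E →L[ℝ] E)) ∈
      closedBall (y₀, ContinuousLinearMap.id ℝ E) (r : ℝ) := by
    intro y hy
    rw [← closedBall_prod_same]
    exact ⟨hy, mem_closedBall_self r.2⟩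
  have hfl : ∀ y ∈ closedBall y₀ (r : ℝ), ∀ t ∈ Icc (-ε) ε,
      (α (y, ContinuousLinearMap.id ℝ E) t).1 = Φ t y := by
    intro y hy t ht
    refine flow_unique_aux hX1 hε (f := fun t => (α (y, ContinuousLinearMap.id ℝ E) t).1)
      (g := fun t => Φ t y) ?_ (fun t _ => (hd t y).hasDerivWithinAt) ?_ ht
    · intro t ht
      have := (hα _ (hmem y hy)).2 t ht
      exact (hasFDerivAt_fst.comp_hasDerivWithinAt t this)
    · simp [(hα _ (hmem y hy)).1, h0]
  refine ⟨ε, hε, r, hr, L, fun p => (α (p.2, ContinuousLinearMap.id ℝ E) p.1).2, ?_, ?_, ?_, ?_⟩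
  · intro t ht
    refine LipschitzOnWith.of_dist_le_mul fun x hx y hy => ?_
    have := (hL t ht).dist_le_mul _ (hmem x hx) _ (hmem y hy)
    rw [← hfl x hx t ht, ← hfl y hy t ht]
    refine le_trans (by rw [Prod.dist_eq]; exact le_max_left _ _) (this.trans ?_)
    simp [Prod.dist_eq]
  · intro y hy
    refine ⟨by simp [(hα _ (hmem y hy)).1], fun t ht => ?_⟩
    have := ((hα _ (hmem y hy)).2 t (Ioo_subset_Icc_self ht)).hasDerivAt (Icc_mem_nhds ht.1 ht.2)
    have h2 := (hasFDerivAt_snd.comp_hasDerivAt t this)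
    rw [← hfl y hy t (Ioo_subset_Icc_self ht)]
    exact h2
  all_goals
    have hc : ContinuousOn (Function.uncurry α)
        (closedBall (y₀, ContinuousLinearMap.id ℝ E) (r : ℝ) ×ˢ Icc (-ε) ε) :=
      continuousOn_prod_of_continuousOn_lipschitzOnWith _ L
        (fun x hx => HasDerivWithinAt.continuousOn (hα x hx).2) hL
    have hc2 : ContinuousOn (fun p : ℝ × E => α (p.2, ContinuousLinearMap.id ℝ E) p.1)
        (Icc (-ε) ε ×ˢ closedBall y₀ (r : ℝ)) :=
      hc.comp (f := fun p : ℝ × E => ((p.2, ContinuousLinearMap.id ℝ E), p.1))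
        (by fun_prop) (fun p hp => ⟨hmem _ hp.2, hp.1⟩)
  · exact continuous_snd.comp_continuousOn hc2
  · exact (continuous_fst.comp_continuousOn hc2).congr fun p hp => (hfl _ hp.2 _ hp.1).symm

theorem unif_diff_aux {E : Type*} [NormedAddCommGroup E] [NormedSpace ℝ E] {X : E → E}
    (hX : ContDiff ℝ 1 X) {S : Set E} (hS : IsCompact S) {c : ℝ} (hc : 0 < c) :
    ∀ᶠ u in 𝓝 (0 : E), ∀ x ∈ S, ‖X (x + u) - X x - fderiv ℝ X x u‖ ≤ c * ‖u‖ := by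
  refine hS.eventually_forall_of_forall_eventually fun x₀ _ => ?_
  have h1 : HasStrictFDerivAt X (fderiv ℝ X x₀) x₀ :=
    hX.contDiffAt.hasStrictFDerivAt one_ne_zero
  have h2 := h1.isLittleO.bound (half_pos hc)
  have ht : Tendsto (fun p : E × E => (p.2 + p.1, p.2)) (𝓝 (0, x₀)) (𝓝 (x₀, x₀)) := by
    have : Continuous (fun p : E × E => (p.2 + p.1, p.2)) := by fun_prop
    simpa using this.tendsto (0, x₀)
  have h3 := ht.eventually h2
  have h4 : ∀ᶠ p in 𝓝 ((0 : E), x₀), ‖fderiv ℝ X p.2 - fderiv ℝ X x₀‖ < c / 2 := by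
    have hcont : Continuous (fun p : E × E => fderiv ℝ X p.2) :=
      (hX.continuous_fderiv one_ne_zero).comp continuous_snd
    have := Metric.tendsto_nhds.1 (hcont.tendsto (0, x₀)) (c / 2) (half_pos hc)
    simpa [dist_eq_norm] using this
  filter_upwards [h3, h4] with p hp3 hp4
  obtain ⟨u, x⟩ := p
  simp only [add_sub_cancel_left] at hp3 hp4 ⊢
  calc ‖X (x + u) - X x - fderiv ℝ X x u‖
      = ‖(X (x + u) - X x - fderiv ℝ X x₀ u) - (fderiv ℝ X x - fderiv ℝ X x₀) u‖ := by
        congr 1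
        simp only [sub_apply]
        abel
    _ ≤ ‖X (x + u) - X x - fderiv ℝ X x₀ u‖ + ‖(fderiv ℝ X x - fderiv ℝ X x₀) u‖ :=
        norm_sub_le _ _
    _ ≤ c / 2 * ‖u‖ + c / 2 * ‖u‖ := by
        gcongr
        exact ((fderiv ℝ X x - fderiv ℝ X x₀).le_opNorm u).trans (by gcongr)
    _ = c * ‖u‖ := by ring

theorem flow_diff_aux {E : Type*} [NormedAddCommGroup E] [NormedSpace ℝ E]
    [FiniteDimensional ℝ E] {X : E → E} (hX : ContDiff ℝ (⊤ : ℕ∞) X) {Φ : ℝ → E → E}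
    (h0 : ∀ y, Φ 0 y = y) (hadd : ∀ s t y, Φ (s + t) y = Φ s (Φ t y))
    (hd : ∀ t y, HasDerivAt (fun s => Φ s y) (X (Φ t y)) t) (y₀ : E) :
    ∃ N : ℝ × E → E →L[ℝ] E,
      (∀ᶠ y in 𝓝 y₀, N (0, y) = ContinuousLinearMap.id ℝ E) ∧
      (∀ᶠ p in 𝓝 ((0 : ℝ), y₀),
        HasDerivAt (fun s => N (s, p.2)) (-((N p).comp (fderiv ℝ X (Φ p.1 p.2)))) p.1) ∧
      (∀ᶠ p in 𝓝 ((0 : ℝ), y₀), HasFDerivAt (Φ (-p.1)) (N p) (Φ p.1 p.2)) ∧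
      ContinuousAt N (0, y₀) ∧ ContinuousAt (fun p : ℝ × E => Φ p.1 p.2) (0, y₀) ∧
      (∀ᶠ p in 𝓝 ((0 : ℝ), y₀), ‖N p‖ ≤ 2) := by
  obtain ⟨ε, hε, r, hr, L, N, hL, hN, hNc, hΦc⟩ := local_flow_aux hX h0 hd y₀
  have hX1 : ContDiff ℝ 1 X := hX.of_le (by exact_mod_cast le_top)
  have hnb : Icc (-ε) ε ×ˢ closedBall y₀ r ∈ 𝓝 ((0 : ℝ), y₀) :=
    prod_mem_nhds (Icc_mem_nhds (by linarith) hε) (closedBall_mem_nhds _ hr)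
  have hnb2 : Ioo (-ε) ε ×ˢ closedBall y₀ r ∈ 𝓝 ((0 : ℝ), y₀) :=
    prod_mem_nhds (Ioo_mem_nhds (by linarith) hε) (closedBall_mem_nhds _ hr)
  have hNc' := hNc.continuousAt hnb
  have hΦc' := hΦc.continuousAt hnb
  have hN2 : ∀ᶠ p in 𝓝 ((0 : ℝ), y₀), ‖N p‖ ≤ 2 := by
    have h1 : ‖N (0, y₀)‖ < 2 := by
      rw [(hN y₀ (mem_closedBall_self hr.le)).1]
      exact lt_of_le_of_lt ContinuousLinearMap.norm_id_le (by norm_num)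
    exact (hNc'.norm.eventually_lt_const h1).mono fun p hp => le_of_lt hp
  refine ⟨N, ?_, ?_, ?_, hNc', hΦc', hN2⟩
  · filter_upwards [closedBall_mem_nhds y₀ hr] with y hy using (hN y hy).1
  · filter_upwards [hnb2] with p hp using (hN p.2 hp.2).2 p.1 hp.1
  -- differentiability
  have hin : ∀ᶠ p in 𝓝 ((0 : ℝ), y₀), Φ p.1 p.2 ∈ ball y₀ r := by
    apply hΦc'.eventually_mem
    simpa [h0] using ball_mem_nhds y₀ hr
  obtain ⟨δ, hδ, hball⟩ := Metric.eventually_nhds_iff_ball.1 ((hin.and hN2).and hnb2)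
  filter_upwards [ball_mem_nhds _ hδ, ball_mem_nhds _ one_pos] with p hp hp1
  obtain ⟨s, y⟩ := p
  have hs : |s| < δ := by
    rw [← ball_prod_same] at hp
    simpa using hp.1
  have hs1 : |s| < 1 := by
    rw [← ball_prod_same] at hp1
    simpa using hp1.1
  have hmem : ∀ τ : ℝ, |τ| ≤ |s| → (τ, y) ∈ ball ((0 : ℝ), y₀) δ := by
    intro τ hτ
    rw [← ball_prod_same] at hp ⊢
    exact ⟨by simpa using lt_of_le_of_lt hτ hs, hp.2⟩
  have hτmem : ∀ τ ∈ uIcc 0 s, |τ| ≤ |s| ∧ |τ - s| ≤ |s| := by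
    intro τ hτ
    rw [mem_uIcc] at hτ
    rcases hτ with ⟨h1, h2⟩ | ⟨h1, h2⟩
    · rw [abs_of_nonneg h1, abs_of_nonneg (h1.trans h2), abs_of_nonpos (by linarith)]
      constructor <;> linarith
    · rw [abs_of_nonpos h2, abs_of_nonpos (h1.trans h2), abs_of_nonneg (by linarith)]
      constructor <;> linarith
  have hsε : |s| < ε := abs_lt.2 (hball _ hp).2.1
  have hxb : Φ s y ∈ ball y₀ r := (hball _ hp).1.1
  simp only
  rw [hasFDerivAt_iff_isLittleO, Asymptotics.isLittleO_iff]
  intro c hc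
  set S := (fun τ => Φ τ y) '' uIcc 0 s with hS
  have hScomp : IsCompact S := isCompact_uIcc.image
    (continuous_iff_continuousAt.2 fun t => (hd t y).continuousAt)
  have hc' : 0 < c / (2 * (L + 1)) := by positivity
  obtain ⟨ρ, hρ, hu⟩ := Metric.eventually_nhds_iff_ball.1 (unif_diff_aux hX1 hScomp hc')
  have hρ' : 0 < ρ / (L + 1) := by positivity
  filter_upwards [ball_mem_nhds _ hρ', isOpen_ball.mem_nhds hxb] with z hz hzr
  have hzn : ‖z - Φ s y‖ < ρ / (L + 1) := by simpa [dist_eq_norm] using hz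
  set u : ℝ → E := fun τ => Φ (τ - s) z - Φ τ y with hudef
  have hun : ∀ τ ∈ uIcc 0 s, ‖u τ‖ ≤ L * ‖z - Φ s y‖ := by
    intro τ hτ
    have h1 : Φ τ y = Φ (τ - s) (Φ s y) := by rw [← hadd]; simp
    simp only [hudef]
    rw [h1]
    have h2 := abs_le.1 ((hτmem τ hτ).2.trans hsε.le)
    have := (hL (τ - s) ⟨h2.1, h2.2⟩).dist_le_mul z (ball_subset_closedBall hzr)
      (Φ s y) (ball_subset_closedBall hxb)
    simpa [dist_eq_norm] using this
  have hud : ∀ τ, HasDerivAt u (X (Φ (τ - s) z) - X (Φ τ y)) τ := by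
    intro τ
    exact ((hd (τ - s) z).comp_sub_const τ s).sub (hd τ y)
  have key := (convex_uIcc (0 : ℝ) s).norm_image_sub_le_of_norm_hasDerivWithin_le
    (f := fun τ => N (τ, y) (u τ))
    (f' := fun τ => (-((N (τ, y)).comp (fderiv ℝ X (Φ τ y)))) (u τ)
      + N (τ, y) (X (Φ (τ - s) z) - X (Φ τ y))) (C := c * ‖z - Φ s y‖)
    (x := s) (y := 0) ?_ ?_ right_mem_uIcc left_mem_uIcc
  · have e1 : N (0, y) = ContinuousLinearMap.id ℝ E :=
      (hN y (hball _ hp).2.2).1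
    simp only [hudef, sub_self, h0, e1, ContinuousLinearMap.id_apply, zero_sub, norm_neg,
      Real.norm_eq_abs] at key
    have e2 : Φ (-s) (Φ s y) = y := by rw [← hadd]; simp [h0]
    rw [e2]
    refine key.trans ?_
    have : 0 ≤ c * ‖z - Φ s y‖ := by positivity
    nlinarith
  · intro τ hτ
    have hτ' := (hτmem τ hτ).1
    have hm := hball _ (hmem τ hτ')
    exact (((hN y hm.2.2).2 τ hm.2.1).clm_apply (hud τ)).hasDerivWithinAt
  · intro τ hτ
    have hτ' := (hτmem τ hτ).1
    have hm := hball _ (hmem τ hτ')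
    have hLle : (L : ℝ) * ‖z - Φ s y‖ ≤ (L + 1) * ‖z - Φ s y‖ := by gcongr; linarith
    have huρ : u τ ∈ ball (0 : E) ρ := by
      rw [mem_ball_zero_iff]
      calc ‖u τ‖ ≤ (L + 1) * ‖z - Φ s y‖ := (hun τ hτ).trans hLle
        _ < (L + 1) * (ρ / (L + 1)) := by gcongr
        _ = ρ := by field_simp
    have h1 := hu (u τ) huρ (Φ τ y) ⟨τ, hτ, rfl⟩
    have h2 : Φ τ y + u τ = Φ (τ - s) z := by simp [hudef]
    rw [h2] at h1
    calc ‖(-((N (τ, y)).comp (fderiv ℝ X (Φ τ y)))) (u τ)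
          + N (τ, y) (X (Φ (τ - s) z) - X (Φ τ y))‖
        = ‖N (τ, y) (X (Φ (τ - s) z) - X (Φ τ y) - fderiv ℝ X (Φ τ y) (u τ))‖ := by
          congr 1
          simp only [map_sub, neg_apply, ContinuousLinearMap.comp_apply]
          abel
      _ ≤ ‖N (τ, y)‖ * ‖X (Φ (τ - s) z) - X (Φ τ y) - fderiv ℝ X (Φ τ y) (u τ)‖ :=
          ContinuousLinearMap.le_opNorm _ _
      _ ≤ 2 * (c / (2 * (L + 1)) * ((L + 1) * ‖z - Φ s y‖)) := by
          gcongr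
          · exact hm.1.2
          · refine h1.trans ?_
            gcongr
            exact (hun τ hτ).trans hLle
      _ = c * ‖z - Φ s y‖ := by field_simp

theorem local_bracket_aux {E : Type*} [NormedAddCommGroup E] [NormedSpace ℝ E]
    [FiniteDimensional ℝ E] {X Y : E → E} (hX : ContDiff ℝ (⊤ : ℕ∞) X)
    (hY : ContDiff ℝ (⊤ : ℕ∞) Y) {Φ : ℝ → E → E}
    (h0 : ∀ y, Φ 0 y = y) (hadd : ∀ s t y, Φ (s + t) y = Φ s (Φ t y))
    (hd : ∀ t y, HasDerivAt (fun s => Φ s y) (X (Φ t y)) t) (y₀ : E) {ε : ℝ} (hε : 0 < ε) :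
    ∀ᶠ p in 𝓝 ((0 : ℝ), y₀), ∃ N : E →L[ℝ] E, HasFDerivAt (Φ (-p.1)) N (Φ p.1 p.2) ∧
      DifferentiableAt ℝ (Φ p.1) p.2 ∧ ‖N‖ ≤ 2 ∧
      ‖N (Y (Φ p.1 p.2)) - Y p.2 - p.1 • lieBracket X Y p.2‖ ≤ ε * |p.1| := by
  obtain ⟨N, hN0, hNd, hfd, hNc, hΦc, hN2⟩ := flow_diff_aux hX h0 hadd hd y₀
  have hX1 : ContDiff ℝ 1 X := hX.of_le (by exact_mod_cast le_top)
  have hY1 : ContDiff ℝ 1 Y := hY.of_le (by exact_mod_cast le_top)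
  have hlb : Continuous (lieBracket X Y) := by
    unfold lieBracket
    exact ((hY1.continuous_fderiv one_ne_zero).clm_apply hX1.continuous).sub
      ((hX1.continuous_fderiv one_ne_zero).clm_apply hY1.continuous)
  have hU := unif_expansion_aux (a := fun p : ℝ × E => N p (Y (Φ p.1 p.2)))
    (b := fun p : ℝ × E => N p (lieBracket X Y (Φ p.1 p.2))) (y₀ := y₀) ?_ ?_ hε
  · have hmap : Tendsto (fun p : ℝ × E => (-p.1, Φ p.1 p.2)) (𝓝 (0, y₀)) (𝓝 (0, y₀)) := by
      have : ContinuousAt (fun p : ℝ × E => (-p.1, Φ p.1 p.2)) (0, y₀) :=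
        (continuous_fst.neg.continuousAt).prodMk hΦc
      simpa [ContinuousAt, h0] using this
    have hfd' := hmap.eventually hfd
    have hN0' : ∀ᶠ p in 𝓝 ((0 : ℝ), y₀), N (0, p.2) = ContinuousLinearMap.id ℝ E :=
      (continuous_snd.tendsto ((0 : ℝ), y₀)).eventually hN0
    filter_upwards [hU, hfd, hfd', hN0', hN2] with p h1 h2 h3 h4 h5
    refine ⟨N p, h2, ?_, h5, ?_⟩
    · have e : Φ (-p.1) (Φ p.1 p.2) = p.2 := by rw [← hadd]; simp [h0]
      simp only [neg_neg, e] at h3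
      exact h3.differentiableAt
    · simpa only [h4, h0, ContinuousLinearMap.id_apply] using h1
  · filter_upwards [hNd] with p hp
    have h1 : HasDerivAt (fun s => Y (Φ s p.2)) (fderiv ℝ Y (Φ p.1 p.2) (X (Φ p.1 p.2))) p.1 :=
      ((hY1.differentiable one_ne_zero _).hasFDerivAt).comp_hasDerivAt p.1 (hd p.1 p.2)
    have h2 := hp.clm_apply h1
    convert h2 using 1
    simp only [lieBracket, map_sub, neg_apply, ContinuousLinearMap.comp_apply]
    abel
  · exact hNc.clm_apply (hlb.continuousAt.comp hΦc)

theorem nested_smooth_aux {E : Type*} [NormedAddCommGroup E] [NormedSpace ℝ E] {p : ℕ}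
    {X : Fin p → E → E} (hX : ∀ i, ContDiff ℝ (⊤ : ℕ∞) (X i)) :
    ∀ I : List (Fin p), ContDiff ℝ (⊤ : ℕ∞) (nestedBracket X I)
  | [] => by simpa [nestedBracket] using contDiff_const
  | [i] => by simpa [nestedBracket] using hX i
  | i :: j :: l => by
    have ih := nested_smooth_aux hX (j :: l)
    simp only [nestedBracket]
    unfold lieBracket
    exact ((contDiff_infty_iff_fderiv.1 ih).2.clm_apply (hX i)).sub
      ((contDiff_infty_iff_fderiv.1 (hX i)).2.clm_apply ih)

theorem base_aux {E : Type*} [NormedAddCommGroup E] [NormedSpace ℝ E]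
    [FiniteDimensional ℝ E] {X : E → E} (hX : ContDiff ℝ (⊤ : ℕ∞) X) {Φ : ℝ → E → E}
    (h0 : ∀ y, Φ 0 y = y) (hadd : ∀ s t y, Φ (s + t) y = Φ s (Φ t y))
    (hd : ∀ t y, HasDerivAt (fun s => Φ s y) (X (Φ t y)) t) (a : ℝ) (c : ℝ → E) (u : E)
    (hc : HasDerivAt c u 0) :
    HasDerivAt (fun t => Φ (a * t) (c t)) (u + a • X (c 0)) 0 := by
  obtain ⟨N, hN0, hNd, hfd, hNc, hΦc, hN2⟩ := flow_diff_aux hX h0 hadd hd (c 0)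
  have hb : ContinuousAt (fun p : ℝ × E => X (Φ p.1 p.2)) (0, c 0) :=
    hX.continuous.continuousAt.comp hΦc
  have hU := fun (ε : ℝ) (hε : 0 < ε) => unif_expansion_aux (a := fun p : ℝ × E => Φ p.1 p.2)
    (b := fun p : ℝ × E => X (Φ p.1 p.2)) (y₀ := c 0)
    (Eventually.of_forall fun p => hd p.1 p.2) hb hε
  simp only [h0] at hU
  have htend : Tendsto (fun t : ℝ => (a * t, c t)) (𝓝 0) (𝓝 (0, c 0)) := by
    have h1 : ContinuousAt (fun t : ℝ => (a * t, c t)) 0 :=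
      (by fun_prop : Continuous fun t : ℝ => a * t).continuousAt.prodMk hc.continuousAt
    simpa [ContinuousAt] using h1
  have hA : HasDerivAt (fun t => Φ (a * t) (c t) - c t - (a * t) • X (c t)) 0 0 := by
    rw [hasDerivAt_iff_isLittleO_nhds_zero, Asymptotics.isLittleO_iff]
    intro ε hε
    have hε' : 0 < ε / (|a| + 1) := by positivity
    filter_upwards [htend.eventually (hU _ hε')] with t ht
    simp only [zero_add, mul_zero, h0, sub_self, zero_smul, smul_zero, sub_zero]
    refine ht.trans ?_
    rw [abs_mul, Real.norm_eq_abs]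
    calc ε / (|a| + 1) * (|a| * |t|) ≤ ε / (|a| + 1) * ((|a| + 1) * |t|) := by
          gcongr; linarith
      _ = ε * |t| := by field_simp
  have hXc : HasDerivAt (fun t => (a * t) • X (c t)) (a • X (c 0)) 0 := by
    have h1 : HasDerivAt (fun t => X (c t)) (fderiv ℝ X (c 0) u) 0 :=
      ((hX.differentiable (by simp) _).hasFDerivAt).comp_hasDerivAt 0 hc
    have h2 : HasDerivAt (fun t : ℝ => a * t) a 0 := by
      simpa using (hasDerivAt_id (0 : ℝ)).const_mul a
    have h3 := h2.smul h1
    simp only [mul_zero, zero_smul, zero_add] at h3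
    exact h3
  have := (hA.add hc).add hXc
  convert this using 1
  · funext t
    simp only [Pi.add_apply]
    abel
  · simp

/-- Family of maps attached to a list of indices and time functions. -/
def famFlow {E : Type*} {p : ℕ} (Φ : Fin p → ℝ → E → E) (M : List (Fin p × (ℝ → ℝ))) (t : ℝ) :
    E → E := compFlows Φ (M.map fun q => (q.1, q.2 t))

theorem compFlows_append_aux {E : Type*} {p : ℕ} (Φ : Fin p → ℝ → E → E)
    (l l' : List (Fin p × ℝ)) (y : E) :
    compFlows Φ (l ++ l') y = compFlows Φ l (compFlows Φ l' y) := by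
  induction l with
  | nil => simp [compFlows]
  | cons q l ih => obtain ⟨i, s⟩ := q; simp [compFlows, ih]

theorem famFlow_append {E : Type*} {p : ℕ} (Φ : Fin p → ℝ → E → E)
    (M M' : List (Fin p × (ℝ → ℝ))) (t : ℝ) (y : E) :
    famFlow Φ (M ++ M') t y = famFlow Φ M t (famFlow Φ M' t y) := by
  simp [famFlow, compFlows_append_aux]

theorem famFlow_scale {E : Type*} {p : ℕ} (Φ : Fin p → ℝ → E → E)
    (M : List (Fin p × (ℝ → ℝ))) (b t : ℝ) :
    famFlow Φ (M.map fun q => (q.1, fun t => q.2 (b * t))) t = famFlow Φ M (b * t) := by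
  simp [famFlow, Function.comp_def]

theorem main_aux {E : Type*} [NormedAddCommGroup E] [NormedSpace ℝ E]
    [FiniteDimensional ℝ E] {p : ℕ} (X : Fin p → E → E)
    (hX : ∀ i, ContDiff ℝ (⊤ : ℕ∞) (X i))
    (Φ : Fin p → ℝ → E → E)
    (hΦ0 : ∀ i y, Φ i 0 y = y)
    (hΦadd : ∀ i s t y, Φ i (s + t) y = Φ i s (Φ i t y))
    (hΦderiv : ∀ i t y, HasDerivAt (fun s => Φ i s y) (X i (Φ i t y)) t) :
    ∀ I : List (Fin p), I ≠ [] → ∀ K : Set E, IsCompact K → ∀ η : ℝ, 0 < η →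
    ∃ M : List (Fin p × (ℝ → ℝ)), M ≠ [] ∧ (∀ q ∈ M, ContDiff ℝ (⊤ : ℕ∞) q.2) ∧
      (∀ y, famFlow Φ M 0 y = y) ∧
      ∀ y ∈ K, ∃ v : E, ‖v - nestedBracket X I y‖ < η ∧
        ∀ (a : ℝ) (c : ℝ → E) (u : E), c 0 = y → HasDerivAt c u 0 →
          HasDerivAt (fun t => famFlow Φ M (a * t) (c t)) (u + a • v) 0
  | [], h => absurd rfl h
  | [i], _ => by
    intro K _ η hη
    refine ⟨[(i, id)], by simp, by simpa using contDiff_id, by simp [famFlow, compFlows, hΦ0], ?_⟩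
    intro y _
    refine ⟨X i y, by simpa [nestedBracket] using hη, ?_⟩
    intro a c u hc0 hc
    have := base_aux (hX i) (hΦ0 i) (hΦadd i) (hΦderiv i) a c u hc
    rw [hc0] at this
    simpa [famFlow, compFlows] using this
  | i :: j :: l, _ => by
    intro K hK η hη
    have ih := main_aux X hX Φ hΦ0 hΦadd hΦderiv (j :: l) (by simp)
    set Y := nestedBracket X (j :: l) with hYdef
    have hY : ContDiff ℝ (⊤ : ℕ∞) Y := nested_smooth_aux hX _
    have hη3 : 0 < η / 3 := by positivity
    have hev := hK.eventually_forall_of_forall_eventually (x₀ := (0 : ℝ))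
      (P := fun s y => ∃ N : E →L[ℝ] E, HasFDerivAt (Φ i (-s)) N (Φ i s y) ∧
        DifferentiableAt ℝ (Φ i s) y ∧ ‖N‖ ≤ 2 ∧
        ‖N (Y (Φ i s y)) - Y y - s • lieBracket (X i) Y y‖ ≤ η / 3 * |s|) fun y _ =>
      local_bracket_aux (hX i) hY (hΦ0 i) (hΦadd i) (hΦderiv i) y hη3
    obtain ⟨δ, hδ, hball⟩ := Metric.eventually_nhds_iff_ball.1 hev
    set s := δ / 2 with hsdef
    have hs : 0 < s := half_pos hδ
    have hsK := hball s (by simp [abs_of_pos hs]; linarith)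
    have hK2 : IsCompact (Φ i s '' K) := by
      apply hK.image_of_continuousOn
      intro y hy
      obtain ⟨N, _, h, _⟩ := hsK y hy
      exact h.continuousAt.continuousWithinAt
    have hη' : 0 < s * η / 9 := by positivity
    obtain ⟨M, hM, hMs, hM0, hMd⟩ := ih (K ∪ Φ i s '' K) (hK.union hK2) _ hη'
    have hinv : ∀ y, Φ i (-s) (Φ i s y) = y := fun y => by rw [← hΦadd]; simp [hΦ0]
    set M' : List (Fin p × (ℝ → ℝ)) :=
      [(i, fun _ => -s)] ++ ((M.map fun q => (q.1, fun t => q.2 (s⁻¹ * t))) ++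
        ([(i, fun _ => s)] ++ (M.map fun q => (q.1, fun t => q.2 (-s⁻¹ * t))))) with hM'
    have hfam : ∀ t y, famFlow Φ M' t y =
        Φ i (-s) (famFlow Φ M (s⁻¹ * t) (Φ i s (famFlow Φ M (-s⁻¹ * t) y))) := by
      intro t y
      rw [hM', famFlow_append, famFlow_append, famFlow_append, famFlow_scale, famFlow_scale]
      simp [famFlow, compFlows]
    refine ⟨M', by simp [hM'], ?_, ?_, ?_⟩
    · intro q hq
      simp only [hM', List.mem_append, List.mem_map, List.mem_singleton] at hq
      rcases hq with rfl | ⟨q', hq', rfl⟩ | rfl | ⟨q', hq', rfl⟩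
      · exact contDiff_const
      · exact (hMs q' hq').comp (contDiff_const.mul contDiff_id)
      · exact contDiff_const
      · exact (hMs q' hq').comp (contDiff_const.mul contDiff_id)
    · intro y
      rw [hfam]
      simp [hM0, hinv]
    · intro y hy
      obtain ⟨N, hNd, hDd, hN2, hNb⟩ := hsK y hy
      obtain ⟨v₁, hv₁, hd₁⟩ := hMd y (Or.inl hy)
      obtain ⟨v₂, hv₂, hd₂⟩ := hMd (Φ i s y) (Or.inr ⟨y, hy, rfl⟩)
      have hND : ∀ w, N (fderiv ℝ (Φ i s) y w) = w := by
        have h1 : HasFDerivAt (fun y => Φ i (-s) (Φ i s y)) (N.comp (fderiv ℝ (Φ i s) y)) y :=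
          hNd.comp y hDd.hasFDerivAt
        have h2 : HasFDerivAt (fun y => Φ i (-s) (Φ i s y)) (ContinuousLinearMap.id ℝ E) y := by
          simp only [hinv]
          exact hasFDerivAt_id y
        intro w
        have := congrArg (fun T : E →L[ℝ] E => T w) (h1.unique h2)
        simpa using this
      refine ⟨s⁻¹ • (N v₂ - v₁), ?_, ?_⟩
      · have e : s⁻¹ • (N v₂ - v₁) - nestedBracket X (i :: j :: l) y =
            s⁻¹ • (N (v₂ - Y (Φ i s y)) - (v₁ - Y y) +
              (N (Y (Φ i s y)) - Y y - s • lieBracket (X i) Y y)) := by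
          have : nestedBracket X (i :: j :: l) y = s⁻¹ • (s • lieBracket (X i) Y y) := by
            rw [smul_smul, inv_mul_cancel₀ hs.ne', one_smul]
            rfl
          rw [this, ← smul_sub, map_sub]
          congr 1
          abel
        rw [e, norm_smul, Real.norm_eq_abs, abs_of_pos (inv_pos.2 hs)]
        rw [abs_of_pos hs] at hNb
        have b1 : ‖N (v₂ - Y (Φ i s y))‖ ≤ 2 * (s * η / 9) :=
          (N.le_opNorm _).trans (by gcongr)
        have b2 : ‖N (v₂ - Y (Φ i s y)) - (v₁ - Y y) +
              (N (Y (Φ i s y)) - Y y - s • lieBracket (X i) Y y)‖ < s * η := by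
          refine lt_of_le_of_lt (norm_add_le _ _) ?_
          have := norm_sub_le (N (v₂ - Y (Φ i s y))) (v₁ - Y y)
          have hpos : 0 < s * η := by positivity
          linarith
        calc _ < s⁻¹ * (s * η) := by gcongr
          _ = η := by field_simp
      · intro a c u hc0 hc
        have g1 := hd₁ (-s⁻¹ * a) c u hc0 hc
        have z1 : famFlow Φ M (-s⁻¹ * a * 0) (c 0) = y := by rw [mul_zero, hM0, hc0]
        have g2 : HasDerivAt (fun t => Φ i s (famFlow Φ M (-s⁻¹ * a * t) (c t)))
            (fderiv ℝ (Φ i s) y (u + (-s⁻¹ * a) • v₁)) 0 :=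
          HasFDerivAt.comp_hasDerivAt (0 : ℝ) (by rw [z1]; exact hDd.hasFDerivAt) g1
        have g3 := hd₂ (s⁻¹ * a) _ _ (by simp only [z1]) g2
        have z3 : famFlow Φ M (s⁻¹ * a * 0) (Φ i s (famFlow Φ M (-s⁻¹ * a * 0) (c 0))) =
            Φ i s y := by rw [z1, mul_zero, hM0]
        have g4 : HasDerivAt (fun t => Φ i (-s) (famFlow Φ M (s⁻¹ * a * t)
            (Φ i s (famFlow Φ M (-s⁻¹ * a * t) (c t)))))
            (N (fderiv ℝ (Φ i s) y (u + (-s⁻¹ * a) • v₁) + (s⁻¹ * a) • v₂)) 0 :=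
          HasFDerivAt.comp_hasDerivAt (0 : ℝ) (by rw [z3]; exact hNd) g3
        convert g4 using 1
        · funext t
          rw [hfam, mul_assoc, mul_assoc]
        · rw [map_add, hND, map_smul]
          module

end Aux

/-- **Approximation of nested brackets by compositions of flows.**
Given C^∞ complete vector fields `X_1, …, X_p` on `ℝ^N` with flows `Φ i`, a nonempty tuple
of indices, a compact set `K` and `η > 0`, there is `δ₀ > 0` such that for all
`δ ∈ (0, δ₀)` there exists a one-parameter family `f_t` of maps which (1) is a composition
`Φ^{ℓ_A}_{σ_{2A}(t)} ∘ ⋯ ∘ Φ^{ℓ_1}_{σ_{A+1}(t)} ∘ Φ^{ℓ_1}_{σ_A(t)} ∘ ⋯ ∘ Φ^{ℓ_A}_{σ_1(t)}`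
(i.e. of `2A` flows whose index sequence is palindromic) with smooth real functions `σ_j`,
(2) satisfies `f_0 = id`, and (3) for every `y ∈ K` the derivative of `t ↦ f_t(y)` at
`t = 0` is within `η` of `X_{(i₁,…,i_r)}(y)`. -/
theorem flow_approximation_of_nested_bracket
    {N p : ℕ} (X : Fin p → EuclideanSpace ℝ (Fin N) → EuclideanSpace ℝ (Fin N))
    (hX : ∀ i, ContDiff ℝ (⊤ : ℕ∞) (X i))
    (Φ : Fin p → ℝ → EuclideanSpace ℝ (Fin N) → EuclideanSpace ℝ (Fin N))
    (hΦ0 : ∀ i y, Φ i 0 y = y)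
    (hΦadd : ∀ i s t y, Φ i (s + t) y = Φ i s (Φ i t y))
    (hΦderiv : ∀ i t y, HasDerivAt (fun s => Φ i s y) (X i (Φ i t y)) t)
    (I : List (Fin p)) (hI : I ≠ [])
    (K : Set (EuclideanSpace ℝ (Fin N))) (hK : IsCompact K) (η : ℝ) (hη : 0 < η) :
    ∃ δ₀ > (0 : ℝ), ∀ δ ∈ Set.Ioo (0 : ℝ) δ₀,
      ∃ (A : ℕ), 1 ≤ A ∧
      ∃ (ℓ : Fin (2 * A) → Fin p) (σ : Fin (2 * A) → ℝ → ℝ),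
        (∀ j, ContDiff ℝ (⊤ : ℕ∞) (σ j)) ∧
        (∀ j k : Fin (2 * A), (j : ℕ) + (k : ℕ) = 2 * A - 1 → ℓ j = ℓ k) ∧
        (∀ y, compFlows Φ (List.ofFn fun j => (ℓ j, σ j 0)) y = y) ∧
        (∀ y ∈ K, ∃ v : EuclideanSpace ℝ (Fin N),
          HasDerivAt (fun t => compFlows Φ (List.ofFn fun j => (ℓ j, σ j t)) y) v 0 ∧
          ‖v - nestedBracket X I y‖ < η) := by
  refine ⟨1, one_pos, fun δ _ => ?_⟩
  obtain ⟨M, hM, hMs, hM0, hMd⟩ := main_aux X hX Φ hΦ0 hΦadd hΦderiv I hI K hK η hη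
  set Z : List (Fin p × (ℝ → ℝ)) := (M.map fun q => (q.1, fun _ => (0 : ℝ))).reverse with hZ
  have hzero : ∀ (l : List (Fin p × (ℝ → ℝ))), (∀ q ∈ l, ∀ t, q.2 t = 0) →
      ∀ t y, famFlow Φ l t y = y := by
    intro l
    induction l with
    | nil => intro _ t y; simp [famFlow, compFlows]
    | cons q l ih =>
      intro h t y
      have h1 := ih (fun q' hq' => h q' (List.mem_cons_of_mem _ hq')) t y
      have h2 := h q List.mem_cons_self t
      simp only [famFlow, List.map_cons, compFlows] at h1 ⊢
      rw [h1, h2, hΦ0]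
  have hZid : ∀ t y, famFlow Φ Z t y = y := by
    refine hzero Z ?_
    intro q hq t
    simp only [hZ, List.mem_reverse, List.mem_map] at hq
    obtain ⟨q', _, rfl⟩ := hq
    rfl
  have hlen : (M ++ Z).length = 2 * M.length := by simp [hZ]; ring
  have hget : ∀ t : ℝ, (List.ofFn fun j : Fin (2 * M.length) =>
      (((M ++ Z)[(j : ℕ)]'(by rw [hlen]; exact j.2)).1,
        ((M ++ Z)[(j : ℕ)]'(by rw [hlen]; exact j.2)).2 t)) =
      (M ++ Z).map fun q => (q.1, q.2 t) := by
    intro t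
    apply List.ext_getElem
    · rw [List.length_ofFn, List.length_map, hlen]
    · intro n h1 h2
      rw [List.getElem_ofFn, List.getElem_map]
  have hfam : ∀ t y, compFlows Φ (List.ofFn fun j : Fin (2 * M.length) =>
      (((M ++ Z)[(j : ℕ)]'(by rw [hlen]; exact j.2)).1,
        ((M ++ Z)[(j : ℕ)]'(by rw [hlen]; exact j.2)).2 t)) y = famFlow Φ M t y := by
    intro t y
    rw [hget]
    have := famFlow_append Φ M Z t y
    rw [hZid] at this
    exact this
  refine ⟨M.length, List.length_pos_iff.2 hM,
    fun j => ((M ++ Z)[(j : ℕ)]'(by rw [hlen]; exact j.2)).1,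
    fun j => ((M ++ Z)[(j : ℕ)]'(by rw [hlen]; exact j.2)).2, ?_, ?_, ?_, ?_⟩
  · intro j
    have hmem : (M ++ Z)[(j : ℕ)]'(by rw [hlen]; exact j.2) ∈ M ++ Z := List.getElem_mem _
    rcases List.mem_append.1 hmem with h | h
    · exact hMs _ h
    · have hall : ∀ q ∈ Z, ContDiff ℝ (⊤ : ℕ∞) q.2 := by
        intro q hq
        simp only [hZ, List.mem_reverse, List.mem_map] at hq
        obtain ⟨q', _, rfl⟩ := hq
        exact contDiff_const
      exact hall _ h
  · have hpal : ∀ a b : ℕ, ∀ (ha : a < (M ++ Z).length) (hb : b < (M ++ Z).length),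
        a < M.length → a + b = 2 * M.length - 1 → ((M ++ Z)[a]).1 = ((M ++ Z)[b]).1 := by
      intro a b ha hb haM hab
      have hbM : M.length ≤ b := by omega
      rw [List.getElem_append_left haM, List.getElem_append_right hbM]
      simp only [hZ, List.getElem_reverse, List.getElem_map, List.length_map]
      congr 2
      omega
    intro j k hjk
    have hj : (j : ℕ) < (M ++ Z).length := by rw [hlen]; exact j.2
    have hk : (k : ℕ) < (M ++ Z).length := by rw [hlen]; exact k.2
    rcases lt_or_ge (j : ℕ) M.length with h | h
    · exact hpal j k hj hk h hjk
    · exact (hpal k j hk hj (by omega) (by omega)).symm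
  · intro y
    exact (hfam 0 y).trans (hM0 y)
  · intro y hy
    obtain ⟨v, hv, hd⟩ := hMd y hy
    refine ⟨v, ?_, hv⟩
    have := hd 1 (fun _ => y) 0 rfl (hasDerivAt_const _ _)
    simp only [one_mul, zero_add, one_smul] at this
    simpa only [hfam] using this
end
end

section
/- Let X_1, …, X_p be C^∞ complete vector fields on ℝ^N, (i_1,…,i_r) an r-tuple of indices with 1 ≤ i_j ≤ p, and define for t ≥ 0 the maps g_{(i_1,…,i_r)t} = G_{(i_1,…,i_r)t^{1/r}} and, for δ > 0 and t ∈ (−δ/2, δ/2), h^δ_t = (g_{(i_1,…,i_r)δ})^{−1} ∘ g_{(i_1,…,i_r)(t+δ)}. Then for every compact set K ⊂ ℝ^N there exist δ_1 > 0 and a constant C_K > 0 such that for all δ ∈ (0, δ_1) and all y ∈ K, ‖(d/dt h^δ_t(y))|_{t=0} − X_{(i_1,…,i_r)}(y)‖ ≤ C_K · δ^{1/r}. -/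
noncomputable section
open Set

variable {E : Type*} [NormedAddCommGroup E] [NormedSpace ℝ E]

/-- The iterated flow-commutator `G_{(i₁,…,i_r)t}` together with its inverse, defined
inductively from the flows `Φ i` by `G_{(k)t} = Φ^{X_k}_t` and
`G_{(k,ℓ₁,…,ℓ_{r−1})t} = Φ^{X_k}_{−t} ∘ G_{(ℓ₁,…,ℓ_{r−1})t} ∘ Φ^{X_k}_{t} ∘ (G_{(ℓ₁,…,ℓ_{r−1})t})⁻¹`. -/
def GmapPair {p : ℕ} (Φ : Fin p → ℝ → E → E) : List (Fin p) → ℝ → (E → E) × (E → E)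
  | [], _ => (id, id)
  | [k], t => (Φ k t, Φ k (-t))
  | k :: j :: l, t =>
      let P := GmapPair Φ (j :: l) t
      (Φ k (-t) ∘ P.1 ∘ Φ k t ∘ P.2, P.1 ∘ Φ k (-t) ∘ P.2 ∘ Φ k t)

section Aux
open Set Topology Filter
open scoped ContDiff unitInterval

universe u

/-- pointwise application of a curve of operators -/
def omegaApp {E F G : Type u} [NormedAddCommGroup E] [NormedSpace ℝ E]
    [NormedAddCommGroup F] [NormedSpace ℝ F] [NormedAddCommGroup G] [NormedSpace ℝ G]
    (b : G →L[ℝ] E →L[ℝ] F) (A : C(I, G)) : C(I, E) →L[ℝ] C(I, F) :=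
  LinearMap.mkContinuous
    { toFun := fun h => (⟨fun s => b (A s) (h s), by fun_prop⟩ : C(I, F))
      map_add' := by intros; ext; simp
      map_smul' := by intros; ext; simp }
    (‖b‖ * ‖A‖) (by
      intro h
      rw [ContinuousMap.norm_le _ (by positivity)]
      intro s
      exact (b (A s)).le_of_opNorm_le_of_le
        (b.le_of_opNorm_le_of_le le_rfl (A.norm_coe_le_norm s)) (h.norm_coe_le_norm s))

theorem omegaApp_apply {E F G : Type u} [NormedAddCommGroup E] [NormedSpace ℝ E]
    [NormedAddCommGroup F] [NormedSpace ℝ F] [NormedAddCommGroup G] [NormedSpace ℝ G]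
    (b : G →L[ℝ] E →L[ℝ] F) (A : C(I, G)) (h : C(I, E)) (s : I) :
    omegaApp b A h s = b (A s) (h s) := rfl

theorem omegaApp_bdd {E F G : Type u} [NormedAddCommGroup E] [NormedSpace ℝ E]
    [NormedAddCommGroup F] [NormedSpace ℝ F] [NormedAddCommGroup G] [NormedSpace ℝ G]
    (b : G →L[ℝ] E →L[ℝ] F) : IsBoundedLinearMap ℝ (omegaApp b) := by
  refine IsLinearMap.with_bound ⟨?_, ?_⟩ ‖b‖ ?_
  · intro x y; ext h s; simp [omegaApp_apply]
  · intro c x; ext h s; simp [omegaApp_apply]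
  · intro A
    exact LinearMap.mkContinuous_norm_le _ (by positivity) _

theorem evalOne_bdd {F : Type u} [NormedAddCommGroup F] [NormedSpace ℝ F] :
    IsBoundedLinearMap ℝ (fun γ : C(I, F) => γ 1) := by
  refine IsLinearMap.with_bound ⟨?_, ?_⟩ 1 ?_
  · intro x y; simp
  · intro c x; simp
  · intro A
    simpa using A.norm_coe_le_norm 1

theorem omega_hasFDerivAt {E F G : Type u} [NormedAddCommGroup E] [NormedSpace ℝ E]
    [NormedAddCommGroup F] [NormedSpace ℝ F] [NormedAddCommGroup G] [NormedSpace ℝ G]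
    (b : G →L[ℝ] E →L[ℝ] F) (f : C(E, F)) (f' : C(E, G))
    (hf : ∀ x, HasFDerivAt f (b (f' x)) x) (γ : C(I, E)) :
    HasFDerivAt (fun γ : C(I, E) => f.comp γ) (omegaApp b (f'.comp γ)) γ := by
  rw [hasFDerivAt_iff_isLittleO, Asymptotics.isLittleO_iff]
  intro c hc
  have hcont : Continuous (fun γ : C(I, E) => f'.comp γ) := ContinuousMap.continuous_postcomp f'
  obtain ⟨d, hd, hd'⟩ := Metric.continuousAt_iff.1 (hcont.continuousAt (x := γ))
    (c / (‖b‖ + 1)) (by positivity)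
  filter_upwards [Metric.ball_mem_nhds γ hd] with η hη
  rw [ContinuousMap.norm_le _ (by positivity)]
  intro s
  simp only [ContinuousMap.sub_apply, omegaApp_apply, ContinuousMap.comp_apply]
  have key := (convex_segment (γ s) (η s)).norm_image_sub_le_of_norm_hasFDerivWithin_le'
    (f := f) (f' := fun x => b (f' x)) (φ := b (f' (γ s))) (C := c)
    (fun x _ => (hf x).hasFDerivWithinAt) ?_ (left_mem_segment ℝ _ _) (right_mem_segment ℝ _ _)
  · exact key.trans (by gcongr; exact (η - γ).norm_coe_le_norm s)
  · rintro x hx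
    rw [segment_eq_image'] at hx
    obtain ⟨θ, hθ, rfl⟩ := hx
    have h1 : dist (γ + θ • (η - γ)) γ < d := by
      rw [dist_eq_norm, add_sub_cancel_left, norm_smul, Real.norm_of_nonneg hθ.1]
      rw [mem_ball_iff_norm] at hη
      calc θ * ‖η - γ‖ ≤ 1 * ‖η - γ‖ := by gcongr; exact hθ.2
        _ < d := by simpa using hη
    have h2 := (hd' h1).le
    rw [dist_eq_norm] at h2
    have h3 := (ContinuousMap.norm_coe_le_norm
      (f'.comp (γ + θ • (η - γ)) - f'.comp γ) s).trans h2
    rw [← map_sub]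
    refine (b.le_of_opNorm_le_of_le (le_add_of_nonneg_right zero_le_one) h3).trans ?_
    rw [mul_div_cancel₀ _ (by positivity)]

theorem omega_step (n : ℕ) {E F G : Type u} [NormedAddCommGroup E] [NormedSpace ℝ E]
    [NormedAddCommGroup F] [NormedSpace ℝ F] [NormedAddCommGroup G] [NormedSpace ℝ G]
    (b : G →L[ℝ] E →L[ℝ] F) (f : C(E, F)) (f' : C(E, G))
    (hf : ∀ x, HasFDerivAt f (b (f' x)) x)
    (ih : ContDiff ℝ n (fun γ : C(I, E) => f'.comp γ)) :
    ContDiff ℝ (n + 1) (fun γ : C(I, E) => f.comp γ) := by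
  rw [contDiff_succ_iff_hasFDerivAt]
  have hO : ContDiff ℝ n (omegaApp b) := (omegaApp_bdd b).contDiff
  exact ⟨fun γ => omegaApp b (f'.comp γ), hO.comp ih,
      omega_hasFDerivAt b f f' hf⟩

theorem omega_contDiff_nat (n : ℕ) {E : Type u} [NormedAddCommGroup E] [NormedSpace ℝ E] :
    ∀ {F : Type u} [NormedAddCommGroup F] [NormedSpace ℝ F] (f : C(E, F)), ContDiff ℝ ∞ f →
      ContDiff ℝ n (fun γ : C(I, E) => f.comp γ) := by
  induction n with
  | zero =>
    intro F _ _ f hf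
    exact contDiff_zero.2 (ContinuousMap.continuous_postcomp f)
  | succ n ih =>
    intro F _ _ f hf
    have h := contDiff_infty_iff_fderiv.1 hf
    rw [Nat.cast_succ]
    exact omega_step n (G := E →L[ℝ] F) (ContinuousLinearMap.id ℝ _) f
      ⟨fderiv ℝ f, h.2.continuous⟩ (fun x => (h.1 x).hasFDerivAt) (ih _ h.2)

theorem omega_contDiff {E F : Type u} [NormedAddCommGroup E] [NormedSpace ℝ E]
    [NormedAddCommGroup F] [NormedSpace ℝ F] (f : C(E, F)) (hf : ContDiff ℝ ∞ f) :
      ContDiff ℝ ∞ (fun γ : C(I, E) => f.comp γ) :=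
  contDiff_infty.2 fun n => omega_contDiff_nat n f hf

/-- extension of a curve -/
def cext {E : Type u} [NormedAddCommGroup E] (γ : C(I, E)) (s : ℝ) : E :=
  γ (projIcc 0 1 zero_le_one s)

theorem cext_cont {E : Type u} [NormedAddCommGroup E] (γ : C(I, E)) : Continuous (cext γ) :=
  γ.continuous.comp continuous_projIcc

theorem cext_apply {E : Type u} [NormedAddCommGroup E] (γ : C(I, E)) (s : I) :
    cext γ s = γ s := by simp [cext]

theorem norm_cext {E : Type u} [NormedAddCommGroup E] (γ : C(I, E)) (s : ℝ) :
    ‖cext γ s‖ ≤ ‖γ‖ := γ.norm_coe_le_norm _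

/-- integration of a curve -/
def cint (E : Type u) [NormedAddCommGroup E] [NormedSpace ℝ E] :
    C(I, E) →L[ℝ] C(I, E) :=
  LinearMap.mkContinuous
    { toFun := fun γ => ⟨fun s => ∫ r in (0:ℝ)..s, cext γ r,
        (intervalIntegral.continuous_primitive
          (fun a b => (cext_cont γ).intervalIntegrable a b) 0).comp continuous_subtype_val⟩
      map_add' := by
        intro γ η
        ext s
        exact intervalIntegral.integral_add ((cext_cont γ).intervalIntegrable _ _)
          ((cext_cont η).intervalIntegrable _ _)
      map_smul' := by
        intro c γ
        ext s
        exact intervalIntegral.integral_smul c (cext γ) }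
    1 (by
      intro γ
      rw [ContinuousMap.norm_le _ (by positivity)]
      intro s
      have := intervalIntegral.norm_integral_le_of_norm_le_const (a := (0:ℝ)) (b := s)
        (f := cext γ) (C := ‖γ‖) (fun x _ => norm_cext γ x)
      refine this.trans ?_
      rw [sub_zero, abs_of_nonneg s.2.1, mul_comm]
      gcongr
      exact s.2.2)

theorem cint_apply {E : Type u} [NormedAddCommGroup E] [NormedSpace ℝ E] (γ : C(I, E)) (s : I) :
    cint E γ s = ∫ r in (0:ℝ)..s, cext γ r := rfl

theorem param_integral {E F : Type u} [NormedAddCommGroup E] [NormedSpace ℝ E]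
    [NormedAddCommGroup F] [NormedSpace ℝ F] (g : E → F) (hg : ContDiff ℝ ∞ g) :
    ContDiff ℝ ∞ (fun q : E × E => ∫ r in (0:ℝ)..1, g (q.1 + r • q.2)) := by
  let f' : C(E, F) := ⟨g, hg.continuous⟩
  let ll : E × E → C(I, E) := fun q => ⟨fun s => q.1 + (s : ℝ) • q.2, by fun_prop⟩
  have hll : ContDiff ℝ ∞ ll := by
    have : IsBoundedLinearMap ℝ ll := by
      refine IsLinearMap.with_bound ⟨?_, ?_⟩ 2 ?_
      · intro x y; ext s; simp [ll]; abel
      · intro c x; ext s; simp [ll, smul_comm c]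
      · intro x
        rw [ContinuousMap.norm_le _ (by positivity)]
        intro s
        simp only [ll, ContinuousMap.coe_mk]
        refine (norm_add_le _ _).trans ?_
        rw [norm_smul, Real.norm_of_nonneg s.2.1]
        have h1 := norm_fst_le x
        have h2 := norm_snd_le x
        have h3 : (s : ℝ) * ‖x.2‖ ≤ 1 * ‖x.2‖ := by gcongr; exact s.2.2
        linarith
    exact this.contDiff
  have hev : ContDiff ℝ ∞ (fun γ : C(I, F) => γ 1) := evalOne_bdd.contDiff
  have hci : ContDiff ℝ ∞ (cint F) := (cint F).contDiff
  have h1 : ContDiff ℝ ∞ (fun q => cint _ (f'.comp (ll q)) 1) :=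
    hev.comp (hci.comp ((omega_contDiff f' hg).comp hll))
  convert h1 using 2 with q
  rw [cint_apply]
  apply intervalIntegral.integral_congr
  intro r hr
  simp only [uIcc_of_le (zero_le_one' ℝ)] at hr
  have := cext_apply (f'.comp (ll q)) ⟨r, hr⟩
  simpa [f', ll] using this.symm

/-- two point Hadamard lemma -/
theorem hadamard_two {E F : Type u} [NormedAddCommGroup E] [NormedSpace ℝ E]
    [NormedAddCommGroup F] [NormedSpace ℝ F] [CompleteSpace F] (f : E → F) (hf : ContDiff ℝ ∞ f) :
    ∃ M : E × E → E →L[ℝ] F, ContDiff ℝ ∞ M ∧ (∀ a w, f (a + w) = f a + M (a, w) w) ∧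
      ∀ a, M (a, 0) = fderiv ℝ f a := by
  have h := contDiff_infty_iff_fderiv.1 hf
  refine ⟨fun q => ∫ r in (0:ℝ)..1, fderiv ℝ f (q.1 + r • q.2), param_integral _ h.2, ?_, ?_⟩
  · intro a w
    have hc : Continuous fun r : ℝ => fderiv ℝ f (a + r • w) :=
      h.2.continuous.comp (by fun_prop)
    simp only
    rw [ContinuousLinearMap.intervalIntegral_apply (hc.intervalIntegrable _ _)]
    have e2 : ∫ r in (0:ℝ)..1, fderiv ℝ f (a + r • w) w
        = f (a + (1:ℝ) • w) - f (a + (0:ℝ) • w) := by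
      apply intervalIntegral.integral_eq_sub_of_hasDerivAt (f := fun r : ℝ => f (a + r • w))
      · intro x hx
        have hd : HasDerivAt (fun r : ℝ => a + r • w) w x := by
          simpa using ((hasDerivAt_id x).smul_const w).const_add a
        exact (h.1 _).hasFDerivAt.comp_hasDerivAt x hd
      · exact (hc.clm_apply continuous_const).intervalIntegrable _ _
    rw [e2]; simp
  · intro a
    simp

theorem flow_eq {E : Type u} [NormedAddCommGroup E] [NormedSpace ℝ E] [FiniteDimensional ℝ E]
    (X : C(E, E)) (hX : ContDiff ℝ ∞ X) (Φ : ℝ → E → E) (h0 : ∀ y, Φ 0 y = y)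
    (hd : ∀ t y, HasDerivAt (fun s => Φ s y) (X (Φ t y)) t) (ε : ℝ) (x : E) (γ : C(I, E))
    (h : γ - ContinuousMap.const I x - ε • cint E (X.comp γ) = 0) : Φ ε x = γ 1 := by
  have : CompleteSpace E := FiniteDimensional.complete ℝ E
  have : ProperSpace E := FiniteDimensional.proper ℝ E
  let f : ℝ → E := fun s => Φ (ε * s) x
  let g : ℝ → E := fun s => x + ε • ∫ r in (0:ℝ)..s, cext (X.comp γ) r
  have hf : ∀ s, HasDerivAt f (ε • X (f s)) s := by
    intro s
    have h1 : HasDerivAt (fun s : ℝ => ε * s) ε s := by simpa using (hasDerivAt_id s).const_mul ε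
    exact (hd (ε * s) x).scomp s h1
  have hg : ∀ s, HasDerivAt g (ε • X (cext γ s)) s := by
    intro s
    exact ((intervalIntegral.integral_hasDerivAt_right
      ((cext_cont (X.comp γ)).intervalIntegrable _ _)
      ((cext_cont (X.comp γ)).stronglyMeasurableAtFilter _ _)
      (cext_cont (X.comp γ)).continuousAt).const_smul ε).const_add x
  have hgγ : ∀ s : I, g s = γ s := by
    intro s
    have := congrArg (fun η : C(I, E) => η s) h
    simp only [ContinuousMap.sub_apply, ContinuousMap.smul_apply, ContinuousMap.const_apply,
      cint_apply, ContinuousMap.zero_apply] at this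
    rw [sub_sub, sub_eq_zero] at this
    exact this.symm
  have hgc : ∀ s ∈ Icc (0:ℝ) 1, cext γ s = g s := by
    intro s hs
    rw [hgγ ⟨s, hs⟩]
    exact cext_apply γ ⟨s, hs⟩
  have hfc : Continuous f := continuous_iff_continuousAt.2 fun s => (hf s).continuousAt
  have hgcont : Continuous g := continuous_iff_continuousAt.2 fun s => (hg s).continuousAt
  obtain ⟨R1, hR1⟩ := ((isCompact_Icc (a := (0:ℝ)) (b := 1)).image hfc).isBounded.subset_closedBall 0
  obtain ⟨R2, hR2⟩ :=
    ((isCompact_Icc (a := (0:ℝ)) (b := 1)).image hgcont).isBounded.subset_closedBall 0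
  let B : Set E := Metric.closedBall 0 (max R1 R2)
  have hB : IsCompact B := isCompact_closedBall _ _
  obtain ⟨C, hC⟩ := hB.exists_bound_of_continuousOn
    (contDiff_infty_iff_fderiv.1 hX).2.continuous.continuousOn
  have hLip : LipschitzOnWith (Real.toNNReal C) X B := by
    apply (convex_closedBall (0:E) (max R1 R2)).lipschitzOnWith_of_nnnorm_fderiv_le (𝕜 := ℝ)
    · intro z _
      exact (contDiff_infty_iff_fderiv.1 hX).1 z
    · intro z hz
      rw [← NNReal.coe_le_coe, coe_nnnorm]
      exact (hC z hz).trans (Real.le_coe_toNNReal C)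
  have hLip2 : LipschitzOnWith (‖ε‖₊ * Real.toNNReal C) (fun z => ε • X z) B := by
    apply LipschitzOnWith.of_dist_le_mul
    intro a ha b hb
    rw [dist_smul₀]
    have := hLip.dist_le_mul a ha b hb
    simp only [NNReal.coe_mul, coe_nnnorm, mul_assoc]
    gcongr
  have key := ODE_solution_unique_of_mem_Icc_right (v := fun _ z => ε • X z) (s := fun _ => B)
    (K := ‖ε‖₊ * Real.toNNReal C) (f := f) (g := g) (a := 0) (b := 1)
    (fun _ _ => hLip2) hfc.continuousOn (fun s _ => (hf s).hasDerivWithinAt)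
    (fun s hs => Metric.closedBall_subset_closedBall (le_max_left _ _)
      (hR1 (mem_image_of_mem f (Ico_subset_Icc_self hs))))
    hgcont.continuousOn
    (fun s hs => by
      rw [← hgc s (Ico_subset_Icc_self hs)]
      exact (hg s).hasDerivWithinAt)
    (fun s hs => Metric.closedBall_subset_closedBall (le_max_right _ _)
      (hR2 (mem_image_of_mem g (Ico_subset_Icc_self hs))))
    (by simp [f, g, h0])
  have h1 := key (right_mem_Icc.2 zero_le_one)
  have h2 := hgγ 1
  simp only [Set.Icc.coe_one] at h2
  rw [h2] at h1
  simpa [f] using h1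

theorem flow_local {E : Type u} [NormedAddCommGroup E] [NormedSpace ℝ E] [FiniteDimensional ℝ E]
    (X : C(E, E)) (hX : ContDiff ℝ ∞ X) (Φ : ℝ → E → E) (h0 : ∀ y, Φ 0 y = y)
    (hd : ∀ t y, HasDerivAt (fun s => Φ s y) (X (Φ t y)) t) (x₀ : E) :
    ContDiffAt ℝ ∞ (fun q : ℝ × E => Φ q.1 q.2) (0, x₀) := by
  have : CompleteSpace E := FiniteDimensional.complete ℝ E
  let F : (ℝ × E) × C(I, E) → C(I, E) := fun u =>
    u.2 - ContinuousMap.const I u.1.2 - u.1.1 • cint E (X.comp u.2)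
  have hconst : ContDiff ℝ ∞ (fun x : E => ContinuousMap.const I x) := by
    have : IsBoundedLinearMap ℝ (fun x : E => ContinuousMap.const I x) := by
      refine IsLinearMap.with_bound ⟨?_, ?_⟩ 1 ?_
      · intro x y; rfl
      · intro c x; rfl
      · intro x
        rw [ContinuousMap.norm_le _ (by positivity)]
        intro s
        simp
    exact this.contDiff
  have hci : ContDiff ℝ ∞ (cint E) := (cint E).contDiff
  have hF : ContDiff ℝ ∞ F :=
    (contDiff_snd.sub (hconst.comp (contDiff_snd.comp contDiff_fst))).sub
      ((contDiff_fst.comp contDiff_fst).smul (hci.comp ((omega_contDiff X hX).comp contDiff_snd)))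
  let u : (ℝ × E) × C(I, E) := ((0, x₀), ContinuousMap.const I x₀)
  have hFu : F u = 0 := by simp [F, u]
  have hinv : (fderiv ℝ F u ∘L .inr ℝ (ℝ × E) C(I, E)) = ContinuousLinearMap.id ℝ _ := by
    have h1 : HasFDerivAt F (fderiv ℝ F u) u := (hF.differentiable (by simp) u).hasFDerivAt
    have h2 : HasFDerivAt (fun γ : C(I, E) => (((0:ℝ), x₀), γ)) (.inr ℝ (ℝ × E) C(I, E))
        (ContinuousMap.const I x₀) := hasFDerivAt_prodMk_right _ _
    have h3 := HasFDerivAt.comp (ContinuousMap.const I x₀) h1 h2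
    have h4 : HasFDerivAt (F ∘ fun γ : C(I, E) => (((0:ℝ), x₀), γ))
        (ContinuousLinearMap.id ℝ _) (ContinuousMap.const I x₀) := by
      have : (F ∘ fun γ : C(I, E) => (((0:ℝ), x₀), γ)) =
          fun γ => γ - ContinuousMap.const I x₀ := by
        funext γ; simp [F]
      rw [this]
      exact (hasFDerivAt_id _).sub_const _
    exact h3.unique h4
  have hinv' : (fderiv ℝ F u ∘L .inr ℝ (ℝ × E) C(I, E)).IsInvertible := by
    rw [hinv]
    exact ⟨ContinuousLinearEquiv.refl ℝ _, rfl⟩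
  have hFa : ContDiffAt ℝ ∞ F u := hF.contDiffAt
  have hψ := hFa.contDiffAt_implicitFunction (by simp) hinv'
  have hev := hFa.eventually_apply_implicitFunction (by simp) hinv'
  have hone : ContDiff ℝ ∞ (fun γ : C(I, E) => γ 1) := evalOne_bdd.contDiff
  refine (hone.contDiffAt.comp (0, x₀) hψ).congr_of_eventuallyEq ?_
  filter_upwards [hev] with q hq
  exact flow_eq X hX Φ h0 hd q.1 q.2 _ (hq.trans hFu)

theorem flow_contDiff {E : Type u} [NormedAddCommGroup E] [NormedSpace ℝ E]
    [FiniteDimensional ℝ E]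
    (X : E → E) (hX : ContDiff ℝ ∞ X) (Φ : ℝ → E → E) (h0 : ∀ y, Φ 0 y = y)
    (hadd : ∀ s t y, Φ (s + t) y = Φ s (Φ t y))
    (hd : ∀ t y, HasDerivAt (fun s => Φ s y) (X (Φ t y)) t) :
    ContDiff ℝ ∞ (fun q : ℝ × E => Φ q.1 q.2) := by
  rw [contDiff_infty]
  intro n
  rw [contDiff_iff_contDiffAt]
  rintro ⟨t, y⟩
  have hloc : ∀ x, ContDiffAt ℝ n (fun q : ℝ × E => Φ q.1 q.2) (0, x) := fun x =>
    (flow_local ⟨X, hX.continuous⟩ hX Φ h0 hd x).of_le (by exact_mod_cast le_top)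
  let A : Set ℝ := {t | ContDiffAt ℝ n (fun q : ℝ × E => Φ q.1 q.2) (t, y)}
  have hopen : IsOpen A := by
    rw [isOpen_iff_mem_nhds]
    intro t ht
    have ht' : ContDiffAt ℝ n (fun q : ℝ × E => Φ q.1 q.2) (t, y) := ht
    have h1 := ht'.eventually (by simp)
    have h2 : Tendsto (fun s : ℝ => (s, y)) (𝓝 t) (𝓝 (t, y)) :=
      (Continuous.prodMk_left y).tendsto t
    exact h2.eventually h1
  have hclosed : IsClosed A := by
    rw [← closure_subset_iff_isClosed]
    intro t ht
    have hc : Continuous fun s => Φ s y :=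
      continuous_iff_continuousAt.2 fun s => (hd s y).continuousAt
    have h1 := (hloc (Φ t y)).eventually (by simp)
    have h2 : Tendsto (fun s : ℝ => (t - s, Φ s y)) (𝓝 t) (𝓝 (0, Φ t y)) := by
      have : Continuous (fun s : ℝ => (t - s, Φ s y)) := by fun_prop
      simpa using this.tendsto t
    have h3 := h2.eventually h1
    obtain ⟨s, hs, hsA⟩ := mem_closure_iff_nhds.1 ht _ h3
    have hsA' : ContDiffAt ℝ n (fun q : ℝ × E => Φ q.1 q.2) (s, y) := hsA
    have h4 : ContDiffAt ℝ n (fun q : ℝ × E => (q.1 - s, Φ s q.2)) (t, y) := by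
      have h5 : ContDiffAt ℝ n (fun q : ℝ × E => (s, q.2)) (t, y) :=
        contDiffAt_const.prodMk contDiffAt_snd
      exact (contDiffAt_fst.sub contDiffAt_const).prodMk
        (ContDiffAt.comp (t, y) (g := fun q : ℝ × E => Φ q.1 q.2) hsA' h5)
    have hs' : ContDiffAt ℝ n (fun q : ℝ × E => Φ q.1 q.2) (t - s, Φ s y) := hs
    have h6 := ContDiffAt.comp (t, y) (g := fun q : ℝ × E => Φ q.1 q.2) hs' h4
    have h7 : ((fun q : ℝ × E => Φ q.1 q.2) ∘ fun q : ℝ × E => (q.1 - s, Φ s q.2)) =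
        fun q : ℝ × E => Φ q.1 q.2 := by
      funext q
      simp [← hadd]
    rw [h7] at h6
    exact h6
  have huniv : A = univ := IsClopen.eq_univ ⟨hclosed, hopen⟩ ⟨0, hloc y⟩
  have ht : t ∈ A := by rw [huniv]; exact mem_univ t
  exact ht

theorem hadamard_snd {E : Type u} [NormedAddCommGroup E] [NormedSpace ℝ E] [CompleteSpace E]
    (S : ℝ × E → E) (hS : ContDiff ℝ ∞ S) :
    ∃ M : (ℝ × E) × E → E →L[ℝ] E, ContDiff ℝ ∞ M ∧
      (∀ t z w, S (t, z + w) = S (t, z) + M ((t, z), w) w) ∧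
      ∀ t z, M ((t, z), 0) = fderiv ℝ (fun z => S (t, z)) z := by
  obtain ⟨M, hM, h1, h2⟩ := hadamard_two S hS
  refine ⟨fun q => M (q.1, (0, q.2)) ∘L .inr ℝ ℝ E, ?_, ?_, ?_⟩
  · exact (hM.comp (contDiff_fst.prodMk (contDiff_const.prodMk contDiff_snd))).clm_comp
      contDiff_const
  · intro t z w
    have := h1 (t, z) (0, w)
    simpa using this
  · intro t z
    have h3 := ((hS.differentiable (by simp) (t, z)).hasFDerivAt).comp z
      (hasFDerivAt_prodMk_right t z)
    have h4 : M ((t, z), ((0:ℝ), (0:E))) = fderiv ℝ S (t, z) := h2 (t, z)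
    simp only [h4]
    exact h3.fderiv.symm

theorem hadamard_fst {E : Type u} [NormedAddCommGroup E] [NormedSpace ℝ E] [CompleteSpace E]
    (S : ℝ × E → E) (hS : ContDiff ℝ ∞ S) :
    ∃ Q : ℝ × E → E, ContDiff ℝ ∞ Q ∧
      (∀ t z, S (t, z) = S (0, z) + t • Q (t, z)) ∧
      ∀ z, HasDerivAt (fun t => S (t, z)) (Q (0, z)) 0 := by
  obtain ⟨M, hM, h1, h2⟩ := hadamard_two S hS
  refine ⟨fun q => M ((0, q.2), (q.1, 0)) (1, 0), ?_, ?_, ?_⟩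
  · exact (hM.comp ((contDiff_const.prodMk contDiff_snd).prodMk
      (contDiff_fst.prodMk contDiff_const))).clm_apply contDiff_const
  · intro t z
    have := h1 (0, z) (t, 0)
    rw [← map_smul]
    simpa using this
  · intro z
    have h3 : HasDerivAt (fun t : ℝ => (t, z)) ((1:ℝ), (0:E)) 0 :=
      (hasDerivAt_id (0:ℝ)).prodMk (hasDerivAt_const _ _)
    have h4 := ((hS.differentiable (by simp) (0, z)).hasFDerivAt).comp_hasDerivAt (0:ℝ) h3
    have h5 : M (((0:ℝ), z), ((0:ℝ), (0:E))) = fderiv ℝ S (0, z) := h2 (0, z)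
    simp only [h5]
    exact h4

theorem comm_step {E : Type u} [NormedAddCommGroup E] [NormedSpace ℝ E] [CompleteSpace E]
    (r : ℕ) (hr : r ≠ 0) (X Y : E → E) (Φ A B : ℝ → E → E) (Q S : ℝ × E → E)
    (hQ : ContDiff ℝ ∞ Q) (hS : ContDiff ℝ ∞ S)
    (hΦ : ContDiff ℝ ∞ fun q : ℝ × E => Φ q.1 q.2)
    (hB : ContDiff ℝ ∞ fun q : ℝ × E => B q.1 q.2)
    (hΦQ : ∀ t y, Φ t y = y + t • Q (t, y)) (hQ0 : ∀ y, Q (0, y) = X y)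
    (hAS : ∀ t y, A t y = y + t ^ r • S (t, y)) (hS0 : ∀ y, S (0, y) = Y y)
    (hΦi : ∀ t y, Φ (-t) (Φ t y) = y) (hAB : ∀ t y, A t (B t y) = y) (hB0 : ∀ y, B 0 y = y) :
    ∃ V : ℝ × E → E, ContDiff ℝ ∞ V ∧
      (∀ t y, Φ (-t) (A t (Φ t (B t y))) = y + t ^ (r + 1) • V (t, y)) ∧
      ∀ y, V (0, y) = lieBracket X Y y := by
  obtain ⟨MS, hMS, hMS1, hMS2⟩ := hadamard_snd S hS
  obtain ⟨MQ, hMQ, hMQ1, hMQ2⟩ := hadamard_snd Q hQ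
  let U : ℝ × E → E := fun q =>
    MS (q, q.1 • Q q) (Q q) - MQ (q, q.1 ^ r • S q) (S q)
  have hU : ContDiff ℝ ∞ U := by fun_prop
  have hw : ∀ t z, A t (Φ t z) = Φ t (A t z) + t ^ (r + 1) • U (t, z) := by
    intro t z
    rw [hAS t (Φ t z), hΦQ t (A t z), hΦQ t z, hAS t z, hMS1, hMQ1]
    simp only [U, map_smul, smul_add, smul_sub, pow_succ, smul_smul, mul_comm t]
    abel
  refine ⟨fun q => U (q.1, B q.1 q.2) -
    q.1 • MQ ((-q.1, Φ q.1 q.2), q.1 ^ (r + 1) • U (q.1, B q.1 q.2)) (U (q.1, B q.1 q.2)),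
    ?_, ?_, ?_⟩
  · have h1 : ContDiff ℝ ∞ (fun q : ℝ × E => U (q.1, B q.1 q.2)) :=
      hU.comp (contDiff_fst.prodMk hB)
    fun_prop
  · intro t y
    rw [hw, hAB, hΦQ (-t), hMQ1]
    have h1 : Φ t y + (-t) • Q (-t, Φ t y) = y := by rw [← hΦQ, hΦi]
    have h2 : ∀ (a b c d : E), a + b + (c + d) = (a + c) + (b + d) := by intros; abel
    rw [smul_add, h2, h1, map_smul]
    simp only [smul_add, smul_neg, neg_mul, neg_smul, smul_smul, mul_comm t, sub_eq_add_neg]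
  · intro y
    simp [U, hB0, hMS2, hMQ2, hQ0, hS0, lieBracket, zero_pow hr]

theorem final_step {E : Type u} [NormedAddCommGroup E] [NormedSpace ℝ E] [CompleteSpace E]
    (r : ℕ) (hr : r ≠ 0) (Y : E → E) (A B : ℝ → E → E) (V : ℝ × E → E)
    (hV : ContDiff ℝ ∞ V)
    (hA : ContDiff ℝ ∞ fun q : ℝ × E => A q.1 q.2)
    (hB : ContDiff ℝ ∞ fun q : ℝ × E => B q.1 q.2)
    (hAV : ∀ t y, A t y = y + t ^ r • V (t, y)) (hV0 : ∀ y, V (0, y) = Y y)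
    (hB0 : ∀ y, B 0 y = y) (K : Set E) (hK : IsCompact K) :
    ∃ δ₁ > (0 : ℝ), ∃ C > (0 : ℝ), ∀ δ ∈ Set.Ioo (0 : ℝ) δ₁,
      ∀ y ∈ K, ∃ v : E,
        HasDerivAt (fun t => B (δ ^ ((r : ℝ)⁻¹)) (A ((t + δ) ^ ((r : ℝ)⁻¹)) y)) v 0 ∧
        ‖v - Y y‖ ≤ C * δ ^ ((r : ℝ)⁻¹) := by
  have hr' : (r : ℝ) ≠ 0 := by exact_mod_cast hr
  let Bh : ℝ × E → E := fun q => B q.1 q.2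
  have hBh : ContDiff ℝ ∞ Bh := hB
  have hdB := (contDiff_infty_iff_fderiv.1 hBh).2
  have hdV := (contDiff_infty_iff_fderiv.1 hV).2
  let Ψ : ℝ × E → E := fun q => fderiv ℝ Bh (q.1, A q.1 q.2)
    ((0:ℝ), V q + (q.1 / r) • fderiv ℝ V q ((1:ℝ), (0:E)))
  have hΨ : ContDiff ℝ ∞ Ψ := by
    have h1 : ContDiff ℝ ∞ (fun q : ℝ × E => fderiv ℝ Bh (q.1, A q.1 q.2)) :=
      hdB.comp (contDiff_fst.prodMk hA)
    have h2 : ContDiff ℝ ∞ (fun q : ℝ × E => fderiv ℝ V q ((1:ℝ), (0:E))) :=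
      hdV.clm_apply contDiff_const
    have h3 : ContDiff ℝ ∞ (fun q : ℝ × E => q.1 / (r : ℝ)) := contDiff_fst.div_const _
    exact h1.clm_apply (contDiff_const.prodMk (hV.add (h3.smul h2)))
  have hΨ0 : ∀ y, Ψ (0, y) = Y y := by
    intro y
    have h1 := ((hBh.differentiable (by simp) (0, y)).hasFDerivAt).comp y
      (hasFDerivAt_prodMk_right (0:ℝ) y)
    have h2 : HasFDerivAt (Bh ∘ fun y => ((0:ℝ), y)) (ContinuousLinearMap.id ℝ E) y := by
      have : (Bh ∘ fun y => ((0:ℝ), y)) = id := by funext z; simp [Bh, hB0]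
      rw [this]
      exact hasFDerivAt_id y
    have h3 := congrArg (fun L : E →L[ℝ] E => L (Y y)) (h1.unique h2)
    have h4 : A 0 y = y := by rw [hAV]; simp [zero_pow hr]
    simpa [Ψ, h4, hV0] using h3
  obtain ⟨Q, hQ, hQ1, -⟩ := hadamard_fst Ψ hΨ
  obtain ⟨C, hC⟩ := ((isCompact_Icc (a := (0:ℝ)) (b := 1)).prod hK).exists_bound_of_continuousOn
    hQ.continuous.continuousOn
  refine ⟨1, one_pos, max C 1, by positivity, ?_⟩
  intro δ hδ y hy
  set τ := δ ^ ((r : ℝ)⁻¹) with hτ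
  have hτ0 : 0 < τ := Real.rpow_pos_of_pos hδ.1 _
  have hτ1 : τ ≤ 1 := Real.rpow_le_one hδ.1.le hδ.2.le (by positivity)
  have hτr : τ ^ r = δ := Real.rpow_inv_natCast_pow hδ.1.le hr
  refine ⟨Ψ (τ, y), ?_, ?_⟩
  · have hs : HasDerivAt (fun t : ℝ => (t + δ) ^ ((r : ℝ)⁻¹)) (τ / (r * δ)) 0 := by
      have h1 : HasDerivAt (fun t : ℝ => t + δ) 1 0 := (hasDerivAt_id _).add_const δ
      have h2 := h1.rpow_const (p := (r : ℝ)⁻¹) (Or.inl (by simpa using hδ.1.ne'))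
      convert h2 using 1
      rw [zero_add, Real.rpow_sub_one hδ.1.ne']
      rw [← hτ]
      field_simp
    have hVd : HasDerivAt (fun s : ℝ => V (s, y)) (fderiv ℝ V (τ, y) ((1:ℝ), (0:E))) τ :=
      ((hV.differentiable (by simp) (τ, y)).hasFDerivAt).comp_hasDerivAt τ
        ((hasDerivAt_id τ).prodMk (hasDerivAt_const _ _))
    have hAd : HasDerivAt (fun s : ℝ => A s y)
        (τ ^ r • fderiv ℝ V (τ, y) ((1:ℝ), (0:E)) + (r * τ ^ (r - 1)) • V (τ, y)) τ := by
      have := ((hasDerivAt_pow r τ).smul hVd).const_add y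
      simp only [hAV]
      exact this
    have hs' : τ = (fun t : ℝ => (t + δ) ^ ((r : ℝ)⁻¹)) 0 := by simp [hτ]
    have hAs : HasDerivAt (fun t : ℝ => A ((t + δ) ^ ((r : ℝ)⁻¹)) y)
        ((τ / (r * δ)) • (τ ^ r • fderiv ℝ V (τ, y) ((1:ℝ), (0:E))
          + (r * τ ^ (r - 1)) • V (τ, y))) 0 :=
      HasDerivAt.scomp_of_eq 0 hAd hs hs'
    have e1 : (τ / (r * δ)) • (τ ^ r • fderiv ℝ V (τ, y) ((1:ℝ), (0:E))
          + (r * τ ^ (r - 1)) • V (τ, y)) =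
          V (τ, y) + (τ / r) • fderiv ℝ V (τ, y) ((1:ℝ), (0:E)) := by
      rw [smul_add, smul_smul, smul_smul, add_comm]
      have hδ0 : δ ≠ 0 := hδ.1.ne'
      congr 1
      · have : τ / (r * δ) * (r * τ ^ (r - 1)) = 1 := by
          have h5 : τ * τ ^ (r - 1) = δ := by rw [mul_pow_sub_one hr, hτr]
          field_simp
          linarith
        rw [this, one_smul]
      · rw [hτr]
        congr 1
        field_simp
    rw [e1] at hAs
    have h6 : HasFDerivAt Bh (fderiv ℝ Bh (τ, A τ y)) (τ, A τ y) :=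
      (hBh.differentiable (by simp) _).hasFDerivAt
    have h7 := (hasDerivAt_const (0:ℝ) τ).prodMk hAs
    exact HasFDerivAt.comp_hasDerivAt_of_eq 0 h6 h7 (by simp [hτ])
  · rw [hQ1 τ y, hΨ0, add_sub_cancel_left, norm_smul, Real.norm_of_nonneg hτ0.le, mul_comm]
    gcongr
    exact (hC (τ, y) ⟨⟨hτ0.le, hτ1⟩, hy⟩).trans (le_max_left _ _)

theorem G_all {E : Type u} [NormedAddCommGroup E] [NormedSpace ℝ E] [FiniteDimensional ℝ E]
    {p : ℕ} (X : Fin p → E → E) (hX : ∀ i, ContDiff ℝ ∞ (X i)) (Φ : Fin p → ℝ → E → E)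
    (hΦ0 : ∀ i y, Φ i 0 y = y)
    (hΦadd : ∀ i s t y, Φ i (s + t) y = Φ i s (Φ i t y))
    (hΦderiv : ∀ i t y, HasDerivAt (fun s => Φ i s y) (X i (Φ i t y)) t)
    (J : List (Fin p)) (hJ : J ≠ []) :
    (ContDiff ℝ ∞ fun q : ℝ × E => (GmapPair Φ J q.1).1 q.2) ∧
    (ContDiff ℝ ∞ fun q : ℝ × E => (GmapPair Φ J q.1).2 q.2) ∧
    (∀ t y, (GmapPair Φ J t).1 ((GmapPair Φ J t).2 y) = y) ∧
    (∀ t y, (GmapPair Φ J t).2 ((GmapPair Φ J t).1 y) = y) ∧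
    (∀ y, (GmapPair Φ J 0).1 y = y) ∧ (∀ y, (GmapPair Φ J 0).2 y = y) ∧
    ∃ V : ℝ × E → E, ContDiff ℝ ∞ V ∧
      (∀ t y, (GmapPair Φ J t).1 y = y + t ^ J.length • V (t, y)) ∧
      ∀ y, V (0, y) = nestedBracket X J y := by
  have : CompleteSpace E := FiniteDimensional.complete ℝ E
  have hΦs : ∀ i, ContDiff ℝ ∞ fun q : ℝ × E => Φ i q.1 q.2 := fun i =>
    flow_contDiff (X i) (hX i) (Φ i) (hΦ0 i) (hΦadd i) (hΦderiv i)
  have hΦn : ∀ i, ContDiff ℝ ∞ fun q : ℝ × E => Φ i (-q.1) q.2 := fun i =>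
    (hΦs i).comp (contDiff_fst.neg.prodMk contDiff_snd)
  have hi1 : ∀ i t y, Φ i (-t) (Φ i t y) = y := fun i t y => by
    rw [← hΦadd, neg_add_cancel, hΦ0]
  have hi2 : ∀ i t y, Φ i t (Φ i (-t) y) = y := fun i t y => by
    rw [← hΦadd, add_neg_cancel, hΦ0]
  have hQ : ∀ i, ∃ V : ℝ × E → E, ContDiff ℝ ∞ V ∧
      (∀ t y, Φ i t y = y + t • V (t, y)) ∧ ∀ y, V (0, y) = X i y := by
    intro i
    obtain ⟨Q, h1, h2, h3⟩ := hadamard_fst _ (hΦs i)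
    refine ⟨Q, h1, fun t y => by simpa [hΦ0] using h2 t y, fun y => ?_⟩
    have := (h3 y).unique (hΦderiv i 0 y)
    rwa [hΦ0] at this
  induction J with
  | nil => exact absurd rfl hJ
  | cons k l ih =>
    cases l with
    | nil =>
      obtain ⟨V, h1, h2, h3⟩ := hQ k
      refine ⟨hΦs k, hΦn k, hi2 k, hi1 k, hΦ0 k, fun y => ?_, V, h1, fun t y => ?_, h3⟩
      · simp [GmapPair, hΦ0]
      · simpa [GmapPair] using h2 t y
    | cons j l =>
      obtain ⟨s1, s2, i1, i2, z1, z2, S, hS, hS1, hS0⟩ := ih (by simp)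
      obtain ⟨Q, hQ, hQ1, hQ0⟩ := hQ k
      have c : ∀ (f : ℝ → E → E) (g : ℝ × E → E), ContDiff ℝ ∞ (fun q : ℝ × E => f q.1 q.2) →
          ContDiff ℝ ∞ g →
          ContDiff ℝ ∞ (fun q : ℝ × E => f q.1 (g q)) := fun f g hf hg =>
        hf.comp (contDiff_fst.prodMk hg)
      refine ⟨?_, ?_, ?_, ?_, ?_, ?_, ?_⟩
      · exact c (fun t => Φ k (-t)) _ (hΦn k) (c (fun t => (GmapPair Φ (j :: l) t).1) _ s1
          (c (Φ k) _ (hΦs k) s2))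
      · exact c (fun t => (GmapPair Φ (j :: l) t).1) _ s1 (c (fun t => Φ k (-t)) _ (hΦn k)
          (c (fun t => (GmapPair Φ (j :: l) t).2) _ s2 (hΦs k)))
      · intro t y
        simp [GmapPair, i1, i2, hi1, hi2]
      · intro t y
        simp [GmapPair, i1, i2, hi1, hi2]
      · intro y
        simp [GmapPair, hΦ0, z1, z2]
      · intro y
        simp [GmapPair, hΦ0, z1, z2]
      · exact comm_step (j :: l).length (by simp) (X k) (nestedBracket X (j :: l)) (Φ k)
          (fun t => (GmapPair Φ (j :: l) t).1) (fun t => (GmapPair Φ (j :: l) t).2) Q S hQ hS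
          (hΦs k) s2 hQ1 hQ0 hS1 hS0 (hi1 k) i1 z2

end Aux

/-- **Quantitative approximation of a nested bracket by the reparametrized commutator
family** `h^δ_t = (g_{(i₁,…,i_r)δ})⁻¹ ∘ g_{(i₁,…,i_r)(t+δ)}` where
`g_{(i₁,…,i_r)t} = G_{(i₁,…,i_r)t^{1/r}}`:  for every compact `K ⊂ ℝ^N` there are
`δ₁ > 0` and `C_K > 0` such that for all `δ ∈ (0, δ₁)` and `y ∈ K`, the derivative at
`t = 0` of `t ↦ h^δ_t(y)` is within `C_K·δ^{1/r}` of `X_{(i₁,…,i_r)}(y)`. -/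
theorem commutator_family_first_derivative_estimate
    {N p : ℕ} (X : Fin p → EuclideanSpace ℝ (Fin N) → EuclideanSpace ℝ (Fin N))
    (hX : ∀ i, ContDiff ℝ (⊤ : ℕ∞) (X i))
    (Φ : Fin p → ℝ → EuclideanSpace ℝ (Fin N) → EuclideanSpace ℝ (Fin N))
    (hΦ0 : ∀ i y, Φ i 0 y = y)
    (hΦadd : ∀ i s t y, Φ i (s + t) y = Φ i s (Φ i t y))
    (hΦderiv : ∀ i t y, HasDerivAt (fun s => Φ i s y) (X i (Φ i t y)) t)
    (I : List (Fin p)) (hI : I ≠ [])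
    (K : Set (EuclideanSpace ℝ (Fin N))) (hK : IsCompact K) :
    ∃ δ₁ > (0 : ℝ), ∃ C > (0 : ℝ), ∀ δ ∈ Set.Ioo (0 : ℝ) δ₁,
      ∀ y ∈ K, ∃ v : EuclideanSpace ℝ (Fin N),
        HasDerivAt
          (fun t => (GmapPair Φ I (δ ^ ((I.length : ℝ)⁻¹))).2
            ((GmapPair Φ I ((t + δ) ^ ((I.length : ℝ)⁻¹))).1 y)) v 0 ∧
        ‖v - nestedBracket X I y‖ ≤ C * δ ^ ((I.length : ℝ)⁻¹) := by
  obtain ⟨s1, s2, -, -, -, z2, V, hV, hV1, hV0⟩ :=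
    G_all X hX Φ hΦ0 hΦadd hΦderiv I hI
  exact final_step I.length (by simpa using hI) (nestedBracket X I)
    (fun t => (GmapPair Φ I t).1) (fun t => (GmapPair Φ I t).2) V hV s1 s2 hV1 hV0 z2 K hK
end
end

section
/- Let X_1 = ∂/∂x¹ and X_2 = ∂/∂x² + x¹ ∂/∂x³ be the generators of the standard contact structure on ℝ³. Then any two points x, x′ ∈ ℝ³ can be joined by a D-path, i.e. by a continuous curve that is a finite concatenation of C¹ arcs, each with nowhere-vanishing derivative tangent at every point y to span{X_1(y), X_2(y)}. -/
noncomputable section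
open Set

variable {E : Type*} [NormedAddCommGroup E] [NormedSpace ℝ E]

/-- A single C¹ regular arc contained in `U`, with nowhere-vanishing derivative tangent
at every point to the distribution `D`, joining `a` to `b`. -/
def IsDArc (U : Set E) (D : E → Submodule ℝ E) (a b : E) : Prop :=
  ∃ γ γ' : ℝ → E,
    γ 0 = a ∧ γ 1 = b ∧ (∀ t ∈ Icc (0:ℝ) 1, γ t ∈ U) ∧
    ContinuousOn γ' (Icc (0:ℝ) 1) ∧
    ∀ t ∈ Icc (0:ℝ) 1, HasDerivWithinAt γ (γ' t) (Icc (0:ℝ) 1) t ∧ γ' t ≠ 0 ∧ γ' t ∈ D (γ t)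

/-- Joined by a D-path: a finite concatenation of D-arcs. -/
def DJoined (U : Set E) (D : E → Submodule ℝ E) : E → E → Prop :=
  Relation.ReflTransGen (IsDArc U D)

lemma dstepA (a b c a' : ℝ) : DJoined Set.univ
      (fun y : Fin 3 → ℝ =>
        Submodule.span ℝ {![(1 : ℝ), 0, 0], ![(0 : ℝ), 1, y 0]})
      ![a, b, c] ![a', b, c] := by
  by_cases h : a' = a
  · subst h; exact Relation.ReflTransGen.refl
  apply Relation.ReflTransGen.single
  refine ⟨fun t => ![a, b, c] + t • ((a' - a) • ![(1 : ℝ), 0, 0]),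
    fun _ => (a' - a) • ![(1 : ℝ), 0, 0], by simp, ?_, by simp, continuousOn_const, ?_⟩
  · ext i; fin_cases i <;> simp
  · intro t _
    refine ⟨?_, ?_, ?_⟩
    · have := ((hasDerivAt_id t).smul_const
        ((a' - a) • ![(1 : ℝ), 0, 0])).const_add ![a, b, c]
      simpa using this.hasDerivWithinAt
    · intro h0
      have := congrFun h0 0
      simp at this
      exact h (by linarith)
    · exact Submodule.smul_mem _ _ (Submodule.subset_span (by simp))

lemma dstepB (a b c s : ℝ) : DJoined Set.univ
      (fun y : Fin 3 → ℝ =>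
        Submodule.span ℝ {![(1 : ℝ), 0, 0], ![(0 : ℝ), 1, y 0]})
      ![a, b, c] ![a, b + s, c + a * s] := by
  by_cases h : s = 0
  · subst h; simp only [mul_zero, add_zero]; exact Relation.ReflTransGen.refl
  apply Relation.ReflTransGen.single
  refine ⟨fun t => ![a, b, c] + t • (s • ![(0 : ℝ), 1, a]),
    fun _ => s • ![(0 : ℝ), 1, a], by simp, ?_, by simp, continuousOn_const, ?_⟩
  · ext i; fin_cases i <;> simp [mul_comm]
  · intro t _
    refine ⟨?_, ?_, ?_⟩
    · have := ((hasDerivAt_id t).smul_const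
        (s • ![(0 : ℝ), 1, a])).const_add ![a, b, c]
      simpa using this.hasDerivWithinAt
    · intro h0
      have := congrFun h0 1
      simp at this
      exact h this
    · exact Submodule.smul_mem _ _ (Submodule.subset_span (by simp))

/-- **Connectivity of the standard contact structure on `ℝ³`.**  For
`X₁ = ∂/∂x¹` and `X₂ = ∂/∂x² + x¹ ∂/∂x³`, any two points of `ℝ³` are joined by a
piecewise C¹ path whose arcs have nowhere-vanishing derivative tangent at each point `y`
to `span{X₁(y), X₂(y)}`. -/
theorem contact_structure_connected (x x' : Fin 3 → ℝ) :
    DJoined Set.univ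
      (fun y : Fin 3 → ℝ =>
        Submodule.span ℝ {![(1 : ℝ), 0, 0], ![(0 : ℝ), 1, y 0]})
      x x' := by
  have h1 := dstepA (x 0) (x 1) (x 2) 0
  have h2 := dstepB 0 (x 1) (x 2) (x' 1 - x 1 - 1)
  have h3 := dstepA 0 (x 1 + (x' 1 - x 1 - 1)) (x 2 + 0 * (x' 1 - x 1 - 1)) (x' 2 - x 2)
  have h4 := dstepB (x' 2 - x 2) (x 1 + (x' 1 - x 1 - 1)) (x 2 + 0 * (x' 1 - x 1 - 1)) 1
  have h5 := dstepA (x' 2 - x 2) (x 1 + (x' 1 - x 1 - 1) + 1)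
    (x 2 + 0 * (x' 1 - x 1 - 1) + (x' 2 - x 2) * 1) (x' 0)
  have h := (((h1.trans h2).trans h3).trans h4).trans h5
  have e1 : ![x 0, x 1, x 2] = x := by
    ext i; fin_cases i <;> rfl
  have e2 : ![x' 0, x 1 + (x' 1 - x 1 - 1) + 1,
      x 2 + 0 * (x' 1 - x 1 - 1) + (x' 2 - x 2) * 1] = x' := by
    ext i; fin_cases i <;> simp
    ring
  rw [e1, e2] at h
  exact h
end
end
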